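/- For every real number M there exists a plane triangulation G such that s_o(G) − s_{o'}(G) > M; that is, the difference between the maximum order of an induced outerplanar subgraph and the maximum order of an induced outerplane subgraph is unbounded over plane triangulations. -/

import Mathlib

/-- A drawing (embedding) of a simple graph in the plane `ℝ × ℝ` without crossings:
vertices are mapped to distinct points, each edge to an injective arc joining its
endpoints, arcs pass through no other vertex, and two arcs of distinct edges meet
only in common endpoints. -/
structure PlaneEmbedding {V : Type} (G : SimpleGraph V) where
  vtx : V → ℝ × ℝ
  vtx_inj : Function.Injective vtx
  arc : ∀ ⦃u v : V⦄, G.Adj u v → Set (ℝ × ℝ)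
  arc_symm : ∀ ⦃u v : V⦄ (h : G.Adj u v), arc h.symm = arc h
  arc_path : ∀ ⦃u v : V⦄ (h : G.Adj u v),
    ∃ γ : Path (vtx u) (vtx v), Function.Injective ⇑γ ∧ Set.range ⇑γ = arc h
  arc_vtx : ∀ ⦃u v : V⦄ (h : G.Adj u v) (w : V), vtx w ∈ arc h → w = u ∨ w = v
  arc_inter : ∀ ⦃u v a b : V⦄ (h₁ : G.Adj u v) (h₂ : G.Adj a b), s(u, v) ≠ s(a, b) →
    arc h₁ ∩ arc h₂ ⊆ ({vtx u, vtx v} : Set (ℝ × ℝ)) ∩ {vtx a, vtx b}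

namespace PlaneEmbedding

variable {V : Type} {G : SimpleGraph V}

/-- The point set of the sub-drawing determined by the vertices in `S`
(the inherited embedding of the induced subgraph on `S`). -/
def subSupport (E : PlaneEmbedding G) (S : Set V) : Set (ℝ × ℝ) :=
  E.vtx '' S ∪ ⋃ (u : V) (_ : u ∈ S) (v : V) (_ : v ∈ S) (h : G.Adj u v), E.arc h

/-- The induced subgraph on `S`, with the inherited embedding, is an outerplane graph:
every vertex of `S` lies on the boundary of the outer (unbounded) face, i.e. in the
closure of the set of points belonging to unbounded faces of the sub-drawing. -/
def OuterplaneOn (E : PlaneEmbedding G) (S : Set V) : Prop :=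
  ∀ v ∈ S, E.vtx v ∈ closure {p | p ∉ E.subSupport S ∧
    ¬ Bornology.IsBounded (connectedComponentIn (E.subSupport S)ᶜ p)}

/-- The whole drawing is an outerplane graph. -/
def IsOuterplane (E : PlaneEmbedding G) : Prop := E.OuterplaneOn Set.univ

end PlaneEmbedding

/-- A graph is planar if it admits a plane embedding. -/
def IsPlanar {V : Type} (G : SimpleGraph V) : Prop := Nonempty (PlaneEmbedding G)

/-- A graph is outerplanar if it admits a plane embedding with all vertices on the
boundary of the outer face. -/
def IsOuterplanar {V : Type} (G : SimpleGraph V) : Prop :=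
  ∃ E : PlaneEmbedding G, E.IsOuterplane

/-- A plane triangulation is an edge-maximal (finite) planar graph. -/
def IsPlaneTriangulation {V : Type} (G : SimpleGraph V) : Prop :=
  IsPlanar G ∧ ∀ u v : V, u ≠ v → ¬ G.Adj u v →
    ¬ IsPlanar (G ⊔ SimpleGraph.fromEdgeSet {s(u, v)})

/-- `G` has a `K_m`-minor: there are `m` pairwise disjoint nonempty connected branch
sets with an edge between any two of them. -/
def HasCliqueMinor {V : Type} (G : SimpleGraph V) (m : ℕ) : Prop :=
  ∃ B : Fin m → Set V,
    (∀ i, (B i).Nonempty) ∧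
    (∀ i, (G.induce (B i)).Connected) ∧
    (∀ i j, i ≠ j → Disjoint (B i) (B j)) ∧
    (∀ i j, i ≠ j → ∃ u ∈ B i, ∃ v ∈ B j, G.Adj u v)

/-- `G` is `K₄`-minor free. -/
def K4MinorFree {V : Type} (G : SimpleGraph V) : Prop := ¬ HasCliqueMinor G 4

/-- `s_{o'}(G)` for a fixed plane embedding of `G`: the maximum order of an induced
subgraph whose inherited embedding is an outerplane graph. -/
noncomputable def sO' {V : Type} [Fintype V] {G : SimpleGraph V}
    (E : PlaneEmbedding G) : ℕ :=
  sSup {n | ∃ S : Finset V, E.OuterplaneOn ↑S ∧ S.card = n}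

/-- `s_o(G)`: the maximum order of an induced outerplanar subgraph of `G`. -/
noncomputable def sO {V : Type} [Fintype V] (G : SimpleGraph V) : ℕ :=
  sSup {n | ∃ S : Finset V, IsOuterplanar (G.induce (↑S : Set V)) ∧ S.card = n}

/-- `s_{K₄}(G)`: the maximum order of an induced `K₄`-minor-free subgraph of `G`. -/
noncomputable def sK4 {V : Type} [Fintype V] (G : SimpleGraph V) : ℕ :=
  sSup {n | ∃ S : Finset V, K4MinorFree (G.induce (↑S : Set V)) ∧ S.card = n}

/-- `tw(G) ≤ k`: `G` admits a tree decomposition of width at most `k`. -/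
def TreewidthLE {V : Type} (G : SimpleGraph V) (k : ℕ) : Prop :=
  ∃ (ι : Type) (T : SimpleGraph ι) (bag : ι → Set V),
    T.IsTree ∧
    (∀ v : V, ∃ i, v ∈ bag i) ∧
    (∀ u v : V, G.Adj u v → ∃ i, u ∈ bag i ∧ v ∈ bag i) ∧
    (∀ v : V, (T.induce {i | v ∈ bag i}).Connected) ∧
    (∀ i, (bag i).ncard ≤ k + 1)

/-- `G` is a `k`-tree: its vertices admit a construction order in which the first
`k+1` vertices form a complete graph and every later vertex is joined to exactly
`k` earlier, pairwise adjacent, vertices. -/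
def IsKTree (k : ℕ) {V : Type} (G : SimpleGraph V) : Prop :=
  ∃ (n : ℕ) (e : Fin n ≃ V), k + 1 ≤ n ∧
    (∀ i j : Fin n, (i : ℕ) < k + 1 → (j : ℕ) < k + 1 → i ≠ j → G.Adj (e i) (e j)) ∧
    (∀ j : Fin n, k + 1 ≤ (j : ℕ) →
      {i : Fin n | i < j ∧ G.Adj (e i) (e j)}.ncard = k ∧
      (∀ i i' : Fin n, i < j → i' < j → G.Adj (e i) (e j) → G.Adj (e i') (e j) →
        i ≠ i' → G.Adj (e i) (e i')))

/-- `S` is a dominating set of `G`. -/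
def IsDomSet {V : Type} (G : SimpleGraph V) (S : Set V) : Prop :=
  ∀ v : V, v ∈ S ∨ ∃ u ∈ S, G.Adj u v

/-- `S` is a connected dominating set of `G`. -/
def IsConnDomSet {V : Type} (G : SimpleGraph V) (S : Set V) : Prop :=
  IsDomSet G S ∧ (G.induce S).Connected

/-- The domination number `γ(G)`. -/
noncomputable def domNum {V : Type} [Fintype V] (G : SimpleGraph V) : ℕ :=
  sInf {n | ∃ S : Finset V, IsDomSet G ↑S ∧ S.card = n}

/-- The connected domination number `γ_c(G)`. -/
noncomputable def connDomNum {V : Type} [Fintype V] (G : SimpleGraph V) : ℕ :=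
  sInf {n | ∃ S : Finset V, IsConnDomSet G ↑S ∧ S.card = n}

/-- A graph is Eulerian if every vertex has even degree. -/
def IsEulerian {V : Type} (G : SimpleGraph V) : Prop :=
  ∀ v : V, Even (G.neighborSet v).ncard

/-- `G` contains a subgraph isomorphic to `H`. -/
def ContainsCopy {W V : Type} (H : SimpleGraph W) (G : SimpleGraph V) : Prop :=
  ∃ f : H →g G, Function.Injective ⇑f

/-- The complete tripartite graph `K_{1,1,3}`. -/
def K113 : SimpleGraph (Fin 5) :=
  SimpleGraph.fromEdgeSet {s(0, 1), s(0, 2), s(0, 3), s(0, 4), s(1, 2), s(1, 3), s(1, 4)}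

/-- `G` is a maximal outerplanar graph. -/
def IsMaximalOuterplanar {V : Type} (G : SimpleGraph V) : Prop :=
  IsOuterplanar G ∧ ∀ u v : V, u ≠ v → ¬ G.Adj u v →
    ¬ IsOuterplanar (G ⊔ SimpleGraph.fromEdgeSet {s(u, v)})

/-- The increment over `[0, 1]` of a continuous logarithm of `f`. -/
noncomputable def logVariation (f : ℝ → ℂ) : ℂ :=
  open Classical in
  if h : ∃ l : C(ℝ, ℂ), ∀ t, Complex.exp (l t) = f t then h.choose 1 - h.choose 0 else 0

theorem exists_continuous_log {A : Type*} [TopologicalSpace A] [SimplyConnectedSpace A]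
    [LocallyPathConnectedSpace A] (a : A) (f : C(A, ℂ)) (hf : ∀ t, f t ≠ 0) :
    ∃ l : C(A, ℂ), ∀ t, Complex.exp (l t) = f t := by
  obtain ⟨l, hl, -⟩ := Complex.isCoveringMapOn_exp.existsUnique_continuousMap_lifts f
    (a₀ := a) (Complex.exp_log (hf a)) hf
  exact ⟨l, congr_fun hl.2⟩

theorem sub_eq_sub_of_exp_eq (l l' : C(ℝ, ℂ)) (c : ℂ)
    (h : ∀ t, Complex.exp (l t) = c * Complex.exp (l' t)) : l 1 - l 0 = l' 1 - l' 0 := by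
  have key := Complex.isCoveringMapOn_exp.existsUnique_continuousMap_lifts
    (⟨fun t => Complex.exp (l t), by fun_prop⟩ : C(ℝ, ℂ)) (a₀ := 0) (e₀ := l 0) rfl
    (fun t => Complex.exp_ne_zero _)
  have hexp : Complex.exp (l 0 - l' 0) = c := by
    rw [Complex.exp_sub, h 0, mul_div_cancel_right₀ _ (Complex.exp_ne_zero _)]
  have := key.unique (y₁ := l) (y₂ := ⟨fun t => l' t + (l 0 - l' 0), by fun_prop⟩)
    ⟨rfl, rfl⟩ ⟨by simp, by
      funext t
      simp [Complex.exp_add, hexp, h t, mul_comm]⟩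
  have h1 := DFunLike.congr_fun this 1
  simp only [ContinuousMap.coe_mk] at h1
  rw [h1]; ring

theorem logVariation_eq (f : ℝ → ℂ) (l : C(ℝ, ℂ)) (c : ℂ) (hc : c ≠ 0)
    (h : ∀ t, Complex.exp (l t) = c * f t) : logVariation f = l 1 - l 0 := by
  have hex : ∃ l : C(ℝ, ℂ), ∀ t, Complex.exp (l t) = f t := by
    refine ⟨⟨fun t => l t - Complex.log c, by fun_prop⟩, fun t => ?_⟩
    simp only [ContinuousMap.coe_mk, Complex.exp_sub, h t, Complex.exp_log hc]
    field_simp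
  rw [logVariation, dif_pos hex]
  exact (sub_eq_sub_of_exp_eq l hex.choose c fun t => by rw [h t, hex.choose_spec t]).symm

theorem exp_logVariation (f : ℝ → ℂ) (hc : Continuous f) (hf : ∀ t, f t ≠ 0) :
    Complex.exp (logVariation f) = f 1 / f 0 := by
  obtain ⟨l, hl⟩ := exists_continuous_log (0 : ℝ) ⟨f, hc⟩ hf
  rw [logVariation_eq f l 1 one_ne_zero (by simpa using hl), Complex.exp_sub, hl, hl]
  rfl

theorem logVariation_square (α β : ℝ → ℂ) (hα : Continuous α) (hβ : Continuous β)
    (h : ∀ s t, α s ≠ β t) :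
    logVariation (fun s => α s - β 0) + logVariation (fun t => β t - α 1) =
      logVariation (fun t => β t - α 0) + logVariation (fun s => α s - β 1) := by
  obtain ⟨l, hl⟩ := exists_continuous_log ((0, 0) : ℝ × ℝ)
    ⟨fun x => α x.1 - β x.2, by fun_prop⟩ (fun x => sub_ne_zero.2 (h _ _))
  simp only [ContinuousMap.coe_mk] at hl
  rw [logVariation_eq (fun s => α s - β 0) ⟨fun s => l (s, 0), by fun_prop⟩ 1 one_ne_zero
      (fun t => by simp [hl]),
    logVariation_eq (fun s => α s - β 1) ⟨fun s => l (s, 1), by fun_prop⟩ 1 one_ne_zero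
      (fun t => by simp [hl]),
    logVariation_eq (fun t => β t - α 0) ⟨fun s => l (0, s), by fun_prop⟩ (-1) (by simp)
      (fun t => by simp [hl]),
    logVariation_eq (fun t => β t - α 1) ⟨fun s => l (1, s), by fun_prop⟩ (-1) (by simp)
      (fun t => by simp [hl])]
  simp only [ContinuousMap.coe_mk]
  ring

/-- In every drawing of `K₅` in the plane some two vertex-disjoint edges meet. -/
theorem not_disjoint_drawing_K5 (p : Fin 5 → ℂ) (γ : ∀ i j : Fin 5, Path (p i) (p j))
    (h : ∀ i j k l : Fin 5, [i, j, k, l].Nodup →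
      i < j → k < l → Disjoint (Set.range (γ i j)) (Set.range (γ k l))) : False := by
  have hne : ∀ i j k l : Fin 5, [i, j, k, l].Nodup → i < j → k < l →
      ∀ s t, (γ i j).extend s ≠ (γ k l).extend t := by
    intro i j k l hn hij hkl s t heq
    refine Set.disjoint_left.1 (h i j k l hn hij hkl) (Set.mem_range_self
      (Set.projIcc 0 1 zero_le_one s)) ?_
    exact ⟨Set.projIcc 0 1 zero_le_one t, heq.symm⟩
  let W : Fin 5 → Fin 5 → Fin 5 → ℂ := fun i j k => logVariation fun t => (γ i j).extend t - p k
  have sq : ∀ i j k l : Fin 5, [i, j, k, l].Nodup → i < j → k < l →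
      W i j k + W k l j = W k l i + W i j l := by
    intro i j k l hn hij hkl
    simpa [W] using logVariation_square _ _ (γ i j).continuous_extend (γ k l).continuous_extend
      (hne i j k l hn hij hkl)
  have hexp : ∀ i j k l : Fin 5, [i, j, k, l].Nodup → i < j → k < l →
      Complex.exp (W i j k) = (p j - p k) / (p i - p k) ∧
      Complex.exp (W i j l) = (p j - p l) / (p i - p l) ∧
      Complex.exp (W k l i) = (p l - p i) / (p k - p i) ∧
      Complex.exp (W k l j) = (p l - p j) / (p k - p j) := by
    intro i j k l hn hij hkl
    have e := hne i j k l hn hij hkl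
    have hc := (γ i j).continuous_extend
    have hc' := (γ k l).continuous_extend
    refine ⟨?_, ?_, ?_, ?_⟩
    · simpa using exp_logVariation (fun t => (γ i j).extend t - p k) (by fun_prop)
        fun t => sub_ne_zero.2 (by simpa using e t 0)
    · simpa using exp_logVariation (fun t => (γ i j).extend t - p l) (by fun_prop)
        fun t => sub_ne_zero.2 (by simpa using e t 1)
    · simpa using exp_logVariation (fun t => (γ k l).extend t - p i) (by fun_prop)
        fun t => sub_ne_zero.2 (by simpa using (e 0 t).symm)
    · simpa using exp_logVariation (fun t => (γ k l).extend t - p j) (by fun_prop)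
        fun t => sub_ne_zero.2 (by simpa using (e 1 t).symm)
  have hp : ∀ i j k l : Fin 5, [i, j, k, l].Nodup → i < j → k < l →
      p i - p k ≠ 0 ∧ p i - p l ≠ 0 ∧ p j - p k ≠ 0 ∧ p j - p l ≠ 0 := by
    intro i j k l hn hij hkl
    have e := hne i j k l hn hij hkl
    exact ⟨sub_ne_zero.2 (by simpa using e 0 0), sub_ne_zero.2 (by simpa using e 0 1),
      sub_ne_zero.2 (by simpa using e 1 0), sub_ne_zero.2 (by simpa using e 1 1)⟩
  have s1 := sq 0 1 2 3 (by decide) (by decide) (by decide)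
  have s2 := sq 0 1 2 4 (by decide) (by decide) (by decide)
  have s3 := sq 0 1 3 4 (by decide) (by decide) (by decide)
  have s4 := sq 0 2 1 3 (by decide) (by decide) (by decide)
  have s5 := sq 0 2 1 4 (by decide) (by decide) (by decide)
  have s6 := sq 0 2 3 4 (by decide) (by decide) (by decide)
  have s7 := sq 0 3 1 2 (by decide) (by decide) (by decide)
  have s8 := sq 0 3 1 4 (by decide) (by decide) (by decide)
  have s9 := sq 0 3 2 4 (by decide) (by decide) (by decide)
  have s10 := sq 0 4 1 2 (by decide) (by decide) (by decide)
  have s11 := sq 0 4 1 3 (by decide) (by decide) (by decide)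
  have s12 := sq 0 4 2 3 (by decide) (by decide) (by decide)
  have s13 := sq 1 2 3 4 (by decide) (by decide) (by decide)
  have s14 := sq 1 3 2 4 (by decide) (by decide) (by decide)
  have s15 := sq 1 4 2 3 (by decide) (by decide) (by decide)
  have hL : W 0 1 2 - W 0 1 4 + W 0 4 1 - W 0 4 2 - W 1 4 0 + W 1 4 2 = 0 := by
    linear_combination (s1 + s2 + s3 - s4 + s5 - s6 - s7 + s8 - s9 + s10 + s11 - s12 + s13 + s14 +
      s15) / 2
  have hE := congr_arg Complex.exp hL
  obtain ⟨e1, e2, -, -⟩ := hexp 0 1 2 4 (by decide) (by decide) (by decide)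
  obtain ⟨e3, e4, -, -⟩ := hexp 0 4 1 2 (by decide) (by decide) (by decide)
  obtain ⟨-, -, e5, e6⟩ := hexp 0 2 1 4 (by decide) (by decide) (by decide)
  obtain ⟨n1, n2, n3, n4⟩ := hp 0 1 2 4 (by decide) (by decide) (by decide)
  obtain ⟨m1, m2, m3, m4⟩ := hp 0 4 1 2 (by decide) (by decide) (by decide)
  have m5 : p 1 - p 0 ≠ 0 := by rwa [← neg_sub, neg_ne_zero]
  rw [Complex.exp_add, Complex.exp_sub, Complex.exp_sub, Complex.exp_add, Complex.exp_sub,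
    e1, e2, e3, e4, e5, e6, Complex.exp_zero] at hE
  have : (-1 : ℂ) = 1 := by
    refine Eq.trans ?_ hE
    have q1 : p 4 - p 1 = -(p 1 - p 4) := by ring
    have q2 : p 4 - p 0 = -(p 0 - p 4) := by ring
    have q3 : p 1 - p 0 = -(p 0 - p 1) := by ring
    rw [q1, q2, q3]
    field_simp
  norm_num at this

namespace PlaneEmbedding

variable {V : Type} {G : SimpleGraph V}

theorem arc_subset_subSupport (E : PlaneEmbedding G) {S : Set V} {u v : V} (hu : u ∈ S)
    (hv : v ∈ S) (h : G.Adj u v) : E.arc h ⊆ E.subSupport S := by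
  intro p hp
  refine Or.inr ?_
  simp only [Set.mem_iUnion]
  exact ⟨u, hu, v, hv, h, hp⟩

theorem disjoint_subSupport (E : PlaneEmbedding G) {A B : Set V} (h : Disjoint A B) :
    Disjoint (E.subSupport A) (E.subSupport B) := by
  have key : ∀ {A B : Set V}, Disjoint A B → ∀ w ∈ A, E.vtx w ∉ E.subSupport B := by
    intro A B h w hw hB
    rcases hB with ⟨b, hb, hbw⟩ | hB
    · exact Set.disjoint_left.1 h hw (E.vtx_inj hbw ▸ hb)
    · simp only [Set.mem_iUnion] at hB
      obtain ⟨a, ha, b, hb, hab, hp⟩ := hB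
      rcases E.arc_vtx hab w hp with rfl | rfl
      · exact Set.disjoint_left.1 h hw ha
      · exact Set.disjoint_left.1 h hw hb
  refine Set.disjoint_left.2 fun p hA hB => ?_
  rcases hA with ⟨a, ha, rfl⟩ | hA
  · exact key h a ha hB
  · have hB' := hB
    rcases hB with ⟨b, hb, rfl⟩ | hB
    · exact key h.symm b hb (Or.inr hA)
    simp only [Set.mem_iUnion] at hA hB
    obtain ⟨a, ha, a', ha', haa, hpa⟩ := hA
    obtain ⟨b, hb, b', hb', hbb, hpb⟩ := hB
    have hne : s(a, a') ≠ s(b, b') := by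
      intro heq
      have : a ∈ s(b, b') := heq ▸ Sym2.mem_mk_left a a'
      rcases Sym2.mem_iff.1 this with rfl | rfl
      · exact Set.disjoint_left.1 h ha hb
      · exact Set.disjoint_left.1 h ha hb'
    rcases (E.arc_inter haa hbb hne ⟨hpa, hpb⟩).1 with rfl | hp
    · exact key h a ha hB'
    · rw [Set.mem_singleton_iff] at hp
      subst hp
      exact key h a' ha' hB'

theorem exists_path_of_reflTransGen (E : PlaneEmbedding G) {A : Set V} {u x : V} (hu : u ∈ A)
    (h : Relation.ReflTransGen (fun a b => G.Adj a b ∧ a ∈ A ∧ b ∈ A) u x) :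
    ∃ γ : Path (E.vtx u) (E.vtx x), Set.range γ ⊆ E.subSupport A := by
  induction h with
  | refl =>
    refine ⟨Path.refl _, ?_⟩
    rw [Path.refl_range, Set.singleton_subset_iff]
    exact Or.inl ⟨u, hu, rfl⟩
  | tail _ hbc ih =>
    obtain ⟨γ, hγ⟩ := ih
    obtain ⟨δ, -, hδ⟩ := E.arc_path hbc.1
    refine ⟨γ.trans δ, ?_⟩
    rw [Path.trans_range, hδ]
    exact Set.union_subset hγ (E.arc_subset_subSupport hbc.2.1 hbc.2.2 hbc.1)

/-- A plane graph has no `K₅` whose edges are realised by connected vertex sets such that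
vertex-disjoint edges of `K₅` get disjoint sets. -/
theorem false_of_K5_model (E : PlaneEmbedding G) (q : Fin 5 → V) (A : Fin 5 → Fin 5 → Set V)
    (hA : ∀ i j k l : Fin 5, [i, j, k, l].Nodup → i < j → k < l → Disjoint (A i j) (A k l))
    (hq : ∀ i j : Fin 5, i < j → q i ∈ A i j ∧
      Relation.ReflTransGen (fun a b => G.Adj a b ∧ a ∈ A i j ∧ b ∈ A i j) (q i) (q j)) :
    False := by
  have hpath : ∀ i j : Fin 5, ∃ γ : Path (E.vtx (q i)) (E.vtx (q j)),
      i < j → Set.range γ ⊆ E.subSupport (A i j) := by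
    intro i j
    by_cases hij : i < j
    · obtain ⟨γ, hγ⟩ := E.exists_path_of_reflTransGen (hq i j hij).1 (hq i j hij).2
      exact ⟨γ, fun _ => hγ⟩
    · exact ⟨(PathConnectedSpace.joined _ _).somePath, fun h => absurd h hij⟩
  choose γ hγ using hpath
  let φ := Complex.equivRealProdCLM.symm
  refine not_disjoint_drawing_K5 (fun i => φ (E.vtx (q i)))
    (fun i j => (γ i j).map φ.continuous) fun i j k l hn hij hkl => ?_
  have h := (E.disjoint_subSupport (hA i j k l hn hij hkl)).mono (hγ i j hij) (hγ k l hkl)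
  simpa only [Path.map_coe, Set.range_comp] using (Set.disjoint_image_iff φ.injective).2 h

end PlaneEmbedding

/-- `i` is one of the earlier neighbours of `j` when vertices are stacked according to `P`:
the first three vertices form a triangle, and each `j ≥ 3` is joined to the triple `P j`. -/
def IsStackParent (P : ℕ → ℕ × ℕ × ℕ) (i j : ℕ) : Prop :=
  i < j ∧ (j < 3 ∨ i = (P j).1 ∨ i = (P j).2.1 ∨ i = (P j).2.2)

/-- The graph on `ℕ` obtained by stacking each vertex `j ≥ 3` onto the triple `P j`. -/
def stackGraph (P : ℕ → ℕ × ℕ × ℕ) : SimpleGraph ℕ where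
  Adj i j := IsStackParent P i j ∨ IsStackParent P j i
  symm := ⟨fun _ _ h => h.symm⟩
  loopless := ⟨fun _ h => by rcases h with h | h <;> exact lt_irrefl _ h.1⟩

/-- Each vertex `j ≥ 3` is stacked onto a triangle of earlier vertices. -/
def IsStacking (P : ℕ → ℕ × ℕ × ℕ) : Prop :=
  ∀ j, 3 ≤ j → (P j).1 < j ∧ (P j).2.1 < j ∧ (P j).2.2 < j ∧
    (stackGraph P).Adj (P j).1 (P j).2.1 ∧ (stackGraph P).Adj (P j).1 (P j).2.2 ∧
    (stackGraph P).Adj (P j).2.1 (P j).2.2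

/-- Deleting two vertices from a stacked graph leaves a connected graph. -/
theorem IsStacking.reflTransGen_avoiding {P : ℕ → ℕ × ℕ × ℕ} (hP : IsStacking P) (y z k : ℕ) :
    ∀ i j, i < k → j < k → i ≠ y → i ≠ z → j ≠ y → j ≠ z →
      Relation.ReflTransGen (fun a b => (stackGraph P).Adj a b ∧ (a < k ∧ a ≠ y ∧ a ≠ z) ∧
        (b < k ∧ b ≠ y ∧ b ≠ z)) i j := by
  induction k with
  | zero => intro i j hi; omega
  | succ k ih =>
    have mono : ∀ i j, i < k → j < k → i ≠ y → i ≠ z → j ≠ y → j ≠ z →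
        Relation.ReflTransGen (fun a b => (stackGraph P).Adj a b ∧ (a < k + 1 ∧ a ≠ y ∧ a ≠ z) ∧
        (b < k + 1 ∧ b ≠ y ∧ b ≠ z)) i j := fun i j hi hj h1 h2 h3 h4 =>
      Relation.ReflTransGen.mono (fun a b h =>
        ⟨h.1, ⟨by omega, h.2.1.2⟩, ⟨by omega, h.2.2.2⟩⟩) _ _ (ih i j hi hj h1 h2 h3 h4)
    have last : ∀ i, i < k → k ≠ y → k ≠ z → i ≠ y → i ≠ z →
        Relation.ReflTransGen (fun a b => (stackGraph P).Adj a b ∧ (a < k + 1 ∧ a ≠ y ∧ a ≠ z) ∧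
        (b < k + 1 ∧ b ≠ y ∧ b ≠ z)) i k := by
      intro i hi h1 h2 h3 h4
      rcases lt_or_ge k 3 with hk | hk
      · exact .single ⟨Or.inl ⟨hi, Or.inl hk⟩, ⟨by omega, h3, h4⟩, ⟨by omega, h1, h2⟩⟩
      · obtain ⟨a1, a2, a3, d1, d2, d3⟩ := hP k hk
        have hm : ∃ m, m < k ∧ m ≠ y ∧ m ≠ z ∧
            (m = (P k).1 ∨ m = (P k).2.1 ∨ m = (P k).2.2) := by
          have := d1.ne
          have := d2.ne
          have := d3.ne
          by_cases e1 : (P k).1 ≠ y ∧ (P k).1 ≠ z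
          · exact ⟨_, a1, e1.1, e1.2, by simp⟩
          by_cases e2 : (P k).2.1 ≠ y ∧ (P k).2.1 ≠ z
          · exact ⟨_, a2, e2.1, e2.2, by simp⟩
          exact ⟨_, a3, by omega, by omega, by simp⟩
        obtain ⟨m, hmk, hmy, hmz, hm⟩ := hm
        exact (mono i m hi hmk h3 h4 hmy hmz).tail
          ⟨Or.inl ⟨hmk, Or.inr hm⟩, ⟨by omega, hmy, hmz⟩, ⟨by omega, h1, h2⟩⟩
    have symm : Std.Symm (fun a b => (stackGraph P).Adj a b ∧ (a < k + 1 ∧ a ≠ y ∧ a ≠ z) ∧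
        (b < k + 1 ∧ b ≠ y ∧ b ≠ z)) := ⟨fun a b h => ⟨h.1.symm, h.2.2, h.2.1⟩⟩
    intro i j hi hj h1 h2 h3 h4
    rcases Nat.lt_succ_iff_lt_or_eq.1 hi with hi | rfl <;>
      rcases Nat.lt_succ_iff_lt_or_eq.1 hj with hj | rfl
    · exact mono i j hi hj h1 h2 h3 h4
    · exact last i hi h3 h4 h1 h2
    · exact Relation.ReflTransGen.stdSymm.symm _ _ (last j hj h1 h2 h3 h4)
    · exact .refl

/-- The restriction of a stacked graph to its first `N` vertices. -/
def finStackGraph (P : ℕ → ℕ × ℕ × ℕ) (N : ℕ) : SimpleGraph (Fin N) :=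
  (stackGraph P).comap Fin.val

theorem IsStacking.not_isPlanar_add_edge {P : ℕ → ℕ × ℕ × ℕ} (hP : IsStacking P) {N : ℕ}
    {u v : Fin N} (huv : u < v) (hadj : ¬ (finStackGraph P N).Adj u v) :
    ¬ IsPlanar (finStackGraph P N ⊔ SimpleGraph.fromEdgeSet {s(u, v)}) := by
  rintro ⟨E⟩
  set G' := finStackGraph P N ⊔ SimpleGraph.fromEdgeSet {s(u, v)}
  have hle : ∀ a b : Fin N, (stackGraph P).Adj a b → G'.Adj a b := fun a b h => Or.inl h
  have huv' : (u : ℕ) < v := huv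
  have hv3 : 3 ≤ (v : ℕ) := by
    by_contra hlt
    exact hadj (Or.inl ⟨huv', Or.inl (by omega)⟩)
  obtain ⟨a1, a2, a3, d1, d2, d3⟩ := hP v hv3
  have hN := v.2
  let x : Fin N := ⟨(P v).1, by omega⟩
  let y : Fin N := ⟨(P v).2.1, by omega⟩
  let z : Fin N := ⟨(P v).2.2, by omega⟩
  have hux : u ≠ x := fun h => hadj (Or.inl ⟨huv', Or.inr (Or.inl (congr_arg Fin.val h))⟩)
  have huy : u ≠ y :=
    fun h => hadj (Or.inl ⟨huv', Or.inr (Or.inr (Or.inl (congr_arg Fin.val h)))⟩)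
  have huz : u ≠ z :=
    fun h => hadj (Or.inl ⟨huv', Or.inr (Or.inr (Or.inr (congr_arg Fin.val h)))⟩)
  have hxv : x < v := a1
  have hyv : y < v := a2
  have hzv : z < v := a3
  have hxy : x ≠ y := fun h => d1.ne (congr_arg Fin.val h)
  have hxz : x ≠ z := fun h => d2.ne (congr_arg Fin.val h)
  have hyz : y ≠ z := fun h => d3.ne (congr_arg Fin.val h)
  have exy : G'.Adj x y := hle _ _ d1
  have exz : G'.Adj x z := hle _ _ d2
  have eyz : G'.Adj y z := hle _ _ d3
  have evx : G'.Adj v x := hle _ _ (Or.inr ⟨a1, by simp [x]⟩)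
  have evy : G'.Adj v y := hle _ _ (Or.inr ⟨a2, by simp [y]⟩)
  have evz : G'.Adj v z := hle _ _ (Or.inr ⟨a3, by simp [z]⟩)
  have euv : G'.Adj u v := Or.inr (by simp [huv.ne])
  let q : Fin 5 → Fin N := ![u, v, x, y, z]
  have hqinj : Function.Injective q := by
    intro i j hij
    have := hxv.ne; have := hyv.ne; have := hzv.ne; have := huv.ne
    fin_cases i <;> fin_cases j <;> simp_all [q]
  have hqadj : ∀ i j : Fin 5, i < j → ¬ (i = 0 ∧ 2 ≤ j) → G'.Adj (q i) (q j) := by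
    intro i j hij hn
    fin_cases i <;> fin_cases j <;> first | (exfalso; revert hij hn; decide) | assumption
  let A : Fin 5 → Fin 5 → Set (Fin N) := fun i j =>
    if i = 0 ∧ 2 ≤ j then {w | w < v ∧ ∀ m, 2 ≤ m → m ≠ j → w ≠ q m} else {q i, q j}
  have hdisj : ∀ j k l : Fin 5, 2 ≤ j → k ≠ 0 → l ≠ 0 → k ≠ j → l ≠ j →
      Disjoint {w : Fin N | w < v ∧ ∀ m, 2 ≤ m → m ≠ j → w ≠ q m} {q k, q l} := by
    intro j k l hj hk hl hkj hlj
    have hmem : ∀ m : Fin 5, m ≠ 0 → m ≠ j → q m < v → ∃ m', 2 ≤ m' ∧ m' ≠ j ∧ q m = q m' := by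
      intro m hm hmj hlt
      refine ⟨m, ?_, hmj, rfl⟩
      by_contra hlt2
      have : m = 1 := by omega
      subst this
      exact lt_irrefl _ hlt
    refine Set.disjoint_left.2 fun w hw hw' => ?_
    rcases hw' with rfl | hw'
    · obtain ⟨m', h1, h2, h3⟩ := hmem k hk hkj hw.1
      exact hw.2 m' h1 h2 h3
    · rw [Set.mem_singleton_iff] at hw'
      subst hw'
      obtain ⟨m', h1, h2, h3⟩ := hmem l hl hlj hw.1
      exact hw.2 m' h1 h2 h3
  refine E.false_of_K5_model q A ?_ ?_
  · intro i j k l hn hij hkl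
    simp only [List.nodup_cons, List.mem_cons, List.not_mem_nil, or_false, not_or,
      List.nodup_nil, and_true] at hn
    obtain ⟨⟨n1, n2, n3⟩, ⟨n4, n5⟩, n6, -⟩ := hn
    by_cases c1 : i = 0 ∧ 2 ≤ j
    · have c2 : ¬ (k = 0 ∧ 2 ≤ l) := fun h => n2 (c1.1.trans h.1.symm)
      simp only [A, if_pos c1, if_neg c2]
      exact hdisj j k l c1.2 (by omega) (by omega) (Ne.symm n4) (Ne.symm n5)
    · by_cases c2 : k = 0 ∧ 2 ≤ l
      · simp only [A, if_neg c1, if_pos c2]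
        exact (hdisj l i j c2.2 (by omega) (by omega) n3 n5).symm
      · simp only [A, if_neg c1, if_neg c2]
        simp [Set.disjoint_left, hqinj.eq_iff, *]
  · intro i j hij
    by_cases c1 : i = 0 ∧ 2 ≤ j
    · simp only [A, if_pos c1]
      obtain ⟨rfl, hj⟩ := c1
      have hqv : ∀ m : Fin 5, 2 ≤ m → q m < v := by
        intro m hm
        fin_cases m <;> first | (exfalso; revert hm; decide) | assumption
      refine ⟨⟨huv, fun m hm _ => hqinj.ne (by omega)⟩, ?_⟩
      obtain ⟨a, b, ha, hb, haj, hbj, hab⟩ : ∃ a b : Fin 5, 2 ≤ a ∧ 2 ≤ b ∧ a ≠ j ∧ b ≠ j ∧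
          ∀ m, 2 ≤ m → m ≠ j → m = a ∨ m = b := by
        clear * - hj
        revert j
        decide
      have hconn := hP.reflTransGen_avoiding (q a) (q b) v (q 0) (q j) huv' (hqv j hj)
        (Fin.val_ne_of_ne (hqinj.ne (by omega))) (Fin.val_ne_of_ne (hqinj.ne (by omega)))
        (Fin.val_ne_of_ne (hqinj.ne haj.symm)) (Fin.val_ne_of_ne (hqinj.ne hbj.symm))
      have lift : ∀ w : ℕ, Relation.ReflTransGen (fun c d => (stackGraph P).Adj c d ∧
          (c < v ∧ c ≠ q a ∧ c ≠ q b) ∧ (d < v ∧ d ≠ q a ∧ d ≠ q b)) (q 0) w →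
          ∀ hw : w < N, Relation.ReflTransGen (fun c d => G'.Adj c d ∧
            c ∈ {w : Fin N | w < v ∧ ∀ m, 2 ≤ m → m ≠ j → w ≠ q m} ∧
            d ∈ {w : Fin N | w < v ∧ ∀ m, 2 ≤ m → m ≠ j → w ≠ q m}) (q 0) ⟨w, hw⟩ := by
        intro w hw
        have hset : ∀ c : Fin N, (c : ℕ) < v ∧ (c : ℕ) ≠ q a ∧ (c : ℕ) ≠ q b →
            c ∈ {w : Fin N | w < v ∧ ∀ m, 2 ≤ m → m ≠ j → w ≠ q m} := by
          rintro c ⟨h1, h2, h3⟩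
          refine ⟨h1, fun m hm hmj hc => ?_⟩
          rcases hab m hm hmj with rfl | rfl
          · exact h2 (congr_arg Fin.val hc)
          · exact h3 (congr_arg Fin.val hc)
        induction hw with
        | refl => intro _; exact .refl
        | @tail c d _ hcd ih =>
          intro hd
          have hc : c < N := by omega
          exact (ih hc).tail ⟨hle ⟨c, hc⟩ ⟨d, hd⟩ hcd.1, hset ⟨c, hc⟩ hcd.2.1,
            hset ⟨d, hd⟩ hcd.2.2⟩
      exact lift _ hconn (q j).2
    · simp only [A, if_neg c1]
      exact ⟨by simp, .single ⟨hqadj i j hij c1, by simp, by simp⟩⟩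

namespace PlaneEmbedding

variable {V : Type} {G : SimpleGraph V}

/-- The straight-line drawing of `G` with vertices placed by `f`. -/
def straightLine (f : V → ℝ × ℝ)
    (h : ∀ u v a b, (u = v ∨ G.Adj u v) → (a = b ∨ G.Adj a b) → s(u, v) ≠ s(a, b) →
      ∀ p ∈ segment ℝ (f u) (f v), p ∈ segment ℝ (f a) (f b) →
        ∃ m, (m = u ∨ m = v) ∧ (m = a ∨ m = b) ∧ p = f m) : PlaneEmbedding G :=
  have hinj : Function.Injective f := by
    intro u v huv
    by_contra hne
    obtain ⟨m, hm, hm', -⟩ := h u u v v (Or.inl rfl) (Or.inl rfl) (by simpa using hne) (f u)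
      (left_mem_segment ℝ _ _) (huv ▸ left_mem_segment ℝ _ _)
    rcases hm with rfl | rfl <;> rcases hm' with rfl | rfl <;> exact hne rfl
  { vtx := f
    vtx_inj := hinj
    arc := fun u v _ => segment ℝ (f u) (f v)
    arc_symm := fun u v _ => segment_symm ℝ _ _
    arc_path := fun u v huv => by
      refine ⟨⟨⟨fun t => AffineMap.lineMap (f u) (f v) (t : ℝ), by fun_prop⟩, by simp, by simp⟩,
        ?_, ?_⟩
      · exact (AffineMap.lineMap_injective ℝ (hinj.ne huv.ne)).comp Subtype.val_injective
      · rw [segment_eq_image_lineMap]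
        ext p
        simp [Set.mem_image]
    arc_vtx := fun u v huv w hw => by
      by_cases hne : s(u, v) = s(w, w)
      · rw [Sym2.eq_iff] at hne
        exact Or.inl (by rcases hne with h | h <;> exact h.1.symm)
      obtain ⟨m, hm, hm', -⟩ := h u v w w (Or.inr huv) (Or.inl rfl) hne (f w) hw
        (left_mem_segment ℝ _ _)
      have : m = w := by simpa using hm'
      exact this ▸ hm
    arc_inter := fun u v a b huv hab hne p hp => by
      obtain ⟨m, hm, hm', rfl⟩ := h u v a b (Or.inr huv) (Or.inr hab) hne p hp.1 hp.2
      refine ⟨?_, ?_⟩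
      · rcases hm with rfl | rfl <;> simp
      · rcases hm' with rfl | rfl <;> simp }

end PlaneEmbedding

theorem mem_segment_parabola {a b : ℝ} {p : ℝ × ℝ} (hab : a ≤ b)
    (hp : p ∈ segment ℝ (a, a ^ 2) (b, b ^ 2)) :
    a ≤ p.1 ∧ p.1 ≤ b ∧ p.2 = p.1 ^ 2 + (p.1 - a) * (b - p.1) := by
  obtain ⟨s, t, hs, ht, hst, rfl⟩ := hp
  obtain rfl : s = 1 - t := by linarith
  refine ⟨?_, ?_, ?_⟩ <;> simp <;> nlinarith

theorem eq_endpoint_of_noncrossing_chords {a b c d x : ℝ} (hax : a ≤ x) (hxb : x ≤ b)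
    (hcx : c ≤ x) (hxd : x ≤ d) (h₁ : a < c → c < b → b < d → False)
    (h₂ : c < a → a < d → d < b → False) (hne : ¬ (a = c ∧ b = d))
    (heq : (x - a) * (b - x) = (x - c) * (d - x)) :
    (x = a ∨ x = b) ∧ (x = c ∨ x = d) := by
  by_cases h0 : (x - a) * (b - x) = 0
  · have h0' := heq ▸ h0
    rw [mul_eq_zero, sub_eq_zero, sub_eq_zero] at h0 h0'
    exact ⟨h0.imp_right Eq.symm, h0'.imp_right Eq.symm⟩
  · exfalso
    have h0' : (x - c) * (d - x) ≠ 0 := heq ▸ h0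
    rw [← ne_eq] at h0
    rw [mul_ne_zero_iff, sub_ne_zero, sub_ne_zero] at h0 h0'
    have ax := lt_of_le_of_ne hax h0.1.symm
    have xb := lt_of_le_of_ne hxb h0.2.symm
    have cx := lt_of_le_of_ne hcx h0'.1.symm
    have xd := lt_of_le_of_ne hxd h0'.2.symm
    rcases lt_trichotomy a c with hac | rfl | hac
    · have hdb : d ≤ b := not_lt.1 fun h => h₁ hac (cx.trans xb) h
      nlinarith [mul_pos (sub_pos.2 hac) (sub_pos.2 xb),
        mul_nonneg (sub_pos.2 cx).le (sub_nonneg.2 hdb)]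
    · have := mul_left_cancel₀ (sub_ne_zero.2 ax.ne') heq
      exact hne ⟨rfl, by linarith⟩
    · have hdb : b ≤ d := not_lt.1 fun h => h₂ hac (ax.trans xd) h
      nlinarith [mul_pos (sub_pos.2 hac) (sub_pos.2 xd),
        mul_nonneg (sub_pos.2 ax).le (sub_nonneg.2 hdb)]

/-- A graph whose vertices are linearly ordered so that no two edges cross is outerplanar. -/
theorem isOuterplanar_of_noncrossing {W : Type} (H : SimpleGraph W) (o : W → ℝ)
    (ho : Function.Injective o)
    (h : ∀ u v a b, H.Adj u v → H.Adj a b → o u < o a → o a < o v → o v < o b → False) :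
    IsOuterplanar H := by
  let f : W → ℝ × ℝ := fun w => (o w, o w ^ 2)
  have ordered : ∀ u v a b, (u = v ∨ H.Adj u v) → (a = b ∨ H.Adj a b) → s(u, v) ≠ s(a, b) →
      o u ≤ o v → o a ≤ o b → ∀ p ∈ segment ℝ (f u) (f v), p ∈ segment ℝ (f a) (f b) →
        ∃ m, (m = u ∨ m = v) ∧ (m = a ∨ m = b) ∧ p = f m := by
    intro u v a b huv hab hne luv lab p hp hp'
    obtain ⟨h1, h2, h3⟩ := mem_segment_parabola luv hp
    obtain ⟨h4, h5, h6⟩ := mem_segment_parabola lab hp'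
    have key := eq_endpoint_of_noncrossing_chords h1 h2 h4 h5
      (fun l1 l2 l3 => ?_) (fun l1 l2 l3 => ?_) (fun hh => ?_) (by linarith)
    · obtain ⟨k1, k2⟩ := key
      have hz : (p.1 - o u) * (o v - p.1) = 0 := by rcases k1 with k | k <;> rw [k] <;> ring
      have hpf : ∀ m, p.1 = o m → p = f m := fun m hm =>
        Prod.ext hm (by rw [h3, hz, add_zero, hm])
      rcases k1 with k1 | k1 <;> rcases k2 with k2 | k2
      · exact ⟨u, Or.inl rfl, Or.inl (ho (k1.symm.trans k2)), hpf _ k1⟩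
      · exact ⟨u, Or.inl rfl, Or.inr (ho (k1.symm.trans k2)), hpf _ k1⟩
      · exact ⟨v, Or.inr rfl, Or.inl (ho (k1.symm.trans k2)), hpf _ k1⟩
      · exact ⟨v, Or.inr rfl, Or.inr (ho (k1.symm.trans k2)), hpf _ k1⟩
    · rcases huv with rfl | huv
      · linarith
      rcases hab with rfl | hab
      · linarith
      exact h u v a b huv hab l1 l2 l3
    · rcases huv with rfl | huv
      · linarith
      rcases hab with rfl | hab
      · linarith
      exact h a b u v hab huv l1 l2 l3
    · exact hne (by rw [ho hh.1, ho hh.2])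
  have hf : ∀ u v a b, (u = v ∨ H.Adj u v) → (a = b ∨ H.Adj a b) → s(u, v) ≠ s(a, b) →
      ∀ p ∈ segment ℝ (f u) (f v), p ∈ segment ℝ (f a) (f b) →
        ∃ m, (m = u ∨ m = v) ∧ (m = a ∨ m = b) ∧ p = f m := by
    intro u v a b huv hab hne p hp hp'
    wlog luv : o u ≤ o v generalizing u v
    · obtain ⟨m, hm, hm'⟩ := this v u (huv.imp Eq.symm SimpleGraph.Adj.symm)
        (by rwa [Sym2.eq_swap]) (by rwa [segment_symm]) (le_of_not_ge luv)
      exact ⟨m, hm.symm, hm'⟩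
    wlog lab : o a ≤ o b generalizing a b
    · obtain ⟨m, hm, hm', hm2⟩ := this b a (hab.imp Eq.symm SimpleGraph.Adj.symm)
        (by rwa [segment_symm]) (by rwa [Sym2.eq_swap (a := b)]) (le_of_not_ge lab)
      exact ⟨m, hm, hm'.symm, hm2⟩
    exact ordered u v a b huv hab hne luv lab p hp hp'
  let E := PlaneEmbedding.straightLine f hf
  have hsupp : ∀ p ∈ E.subSupport Set.univ, p.1 ^ 2 ≤ p.2 := by
    rintro p (⟨w, -, rfl⟩ | hp)
    · exact le_rfl
    · simp only [Set.mem_iUnion] at hp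
      obtain ⟨u, -, v, -, huv, hp⟩ := hp
      change p ∈ segment ℝ (f u) (f v) at hp
      rcases le_total (o u) (o v) with l | l
      · obtain ⟨h1, h2, h3⟩ := mem_segment_parabola l hp
        nlinarith [mul_nonneg (sub_nonneg.2 h1) (sub_nonneg.2 h2)]
      · rw [segment_symm] at hp
        obtain ⟨h1, h2, h3⟩ := mem_segment_parabola l hp
        nlinarith [mul_nonneg (sub_nonneg.2 h1) (sub_nonneg.2 h2)]
  refine ⟨E, fun w _ => ?_⟩
  have hray : ∀ y < o w ^ 2, (o w, y) ∈ {p | p ∉ E.subSupport Set.univ ∧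
      ¬ Bornology.IsBounded (connectedComponentIn (E.subSupport Set.univ)ᶜ p)} := by
    intro y hy
    have hout : ∀ y' < o w ^ 2, (o w, y') ∈ (E.subSupport Set.univ)ᶜ :=
      fun y' hy' hmem => absurd (hsupp _ hmem) (not_le.2 hy')
    refine ⟨hout y hy, fun hb => ?_⟩
    have hsub : (fun y' : ℝ => (o w, y')) '' Set.Iio (o w ^ 2) ⊆
        connectedComponentIn (E.subSupport Set.univ)ᶜ (o w, y) := by
      refine IsPreconnected.subset_connectedComponentIn
        (isPreconnected_Iio.image _ (by fun_prop)) ⟨y, hy, rfl⟩ ?_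
      rintro _ ⟨y', hy', rfl⟩
      exact hout y' hy'
    have hb2 := (hb.subset hsub).image_snd
    rw [Set.image_image] at hb2
    simp only [Set.image_id'] at hb2
    exact not_bddBelow_Iio _ hb2.bddBelow
  change (o w, o w ^ 2) ∈ _
  have hlim : Filter.Tendsto (fun y : ℝ => (o w, y)) (nhdsWithin (o w ^ 2) (Set.Iio (o w ^ 2)))
      (nhds (o w, o w ^ 2)) :=
    (Continuous.tendsto (by fun_prop : Continuous fun y : ℝ => (o w, y)) _).mono_left
      nhdsWithin_le_nhds
  exact mem_closure_of_tendsto hlim (eventually_nhdsWithin_of_forall hray)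

/-- Twice the signed area of a triangle. -/
def orient (a b c : ℝ × ℝ) : ℝ := (b.1 - a.1) * (c.2 - a.2) - (b.2 - a.2) * (c.1 - a.1)

/-- The open triangle with corners `a`, `b`, `c`. -/
def openTriangle (a b c : ℝ × ℝ) : Set (ℝ × ℝ) :=
  {p | ∃ α β γ : ℝ, 0 < α ∧ 0 < β ∧ 0 < γ ∧ α + β + γ = 1 ∧ p = α • a + β • b + γ • c}

theorem barycentric_unique {a b c : ℝ × ℝ} (h : orient a b c ≠ 0) {α β γ α' β' γ' : ℝ}
    (h₁ : α + β + γ = 1) (h₂ : α' + β' + γ' = 1)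
    (heq : α • a + β • b + γ • c = α' • a + β' • b + γ' • c) : α = α' ∧ β = β' ∧ γ = γ' := by
  have e1 := congr_arg Prod.fst heq
  have e2 := congr_arg Prod.snd heq
  simp only [Prod.fst_add, Prod.snd_add, Prod.smul_fst, Prod.smul_snd, smul_eq_mul] at e1 e2
  unfold orient at h
  have hβ : β = β' := by
    apply mul_left_cancel₀ h
    linear_combination (c.2 - a.2) * e1 - (c.1 - a.1) * e2 +
      (a.2 * c.1 - a.1 * c.2) * (h₁ - h₂)
  have hγ : γ = γ' := by
    apply mul_left_cancel₀ h
    linear_combination (b.1 - a.1) * e2 - (b.2 - a.2) * e1 +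
      (b.2 * a.1 - b.1 * a.2) * (h₁ - h₂)
  exact ⟨by linarith, hβ, hγ⟩

theorem barycentric_eq {a b c : ℝ × ℝ} (h : orient a b c ≠ 0) (p : ℝ × ℝ) :
    orient p b c / orient a b c + orient a p c / orient a b c + orient a b p / orient a b c = 1 ∧
    p = (orient p b c / orient a b c) • a + (orient a p c / orient a b c) • b +
      (orient a b p / orient a b c) • c := by
  refine ⟨?_, Prod.ext ?_ ?_⟩
  · rw [← add_div, ← add_div, div_eq_one_iff_eq h]
    unfold orient; ring
  · simp only [Prod.fst_add, Prod.smul_fst, smul_eq_mul]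
    rw [div_mul_eq_mul_div, div_mul_eq_mul_div, div_mul_eq_mul_div, ← add_div, ← add_div,
      eq_div_iff h]
    unfold orient; ring
  · simp only [Prod.snd_add, Prod.smul_snd, smul_eq_mul]
    rw [div_mul_eq_mul_div, div_mul_eq_mul_div, div_mul_eq_mul_div, ← add_div, ← add_div,
      eq_div_iff h]
    unfold orient; ring

theorem mem_openTriangle_iff {a b c : ℝ × ℝ} (h : orient a b c ≠ 0) (p : ℝ × ℝ) :
    p ∈ openTriangle a b c ↔ 0 < orient p b c / orient a b c ∧
      0 < orient a p c / orient a b c ∧ 0 < orient a b p / orient a b c := by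
  obtain ⟨h1, h2⟩ := barycentric_eq h p
  constructor
  · rintro ⟨α, β, γ, hα, hβ, hγ, hs, hp⟩
    obtain ⟨rfl, rfl, rfl⟩ := barycentric_unique h hs h1 (hp.symm.trans h2)
    exact ⟨hα, hβ, hγ⟩
  · rintro ⟨hα, hβ, hγ⟩
    exact ⟨_, _, _, hα, hβ, hγ, h1, h2⟩

theorem isBounded_openTriangle (a b c : ℝ × ℝ) : Bornology.IsBounded (openTriangle a b c) := by
  refine isBounded_iff_forall_norm_le.2 ⟨‖a‖ + ‖b‖ + ‖c‖, ?_⟩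
  rintro p ⟨α, β, γ, hα, hβ, hγ, hs, rfl⟩
  refine (norm_add₃_le).trans ?_
  rw [norm_smul_of_nonneg hα.le, norm_smul_of_nonneg hβ.le, norm_smul_of_nonneg hγ.le]
  have bound : ∀ {r : ℝ} (x : ℝ × ℝ), r ≤ 1 → r * ‖x‖ ≤ ‖x‖ :=
    fun x hr => mul_le_of_le_one_left (norm_nonneg x) hr
  exact add_le_add (add_le_add (bound a (by linarith)) (bound b (by linarith)))
    (bound c (by linarith))

theorem isOpen_openTriangle {a b c : ℝ × ℝ} (h : orient a b c ≠ 0) :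
    IsOpen (openTriangle a b c) := by
  have : openTriangle a b c = {p | 0 < orient p b c / orient a b c} ∩
      ({p | 0 < orient a p c / orient a b c} ∩ {p | 0 < orient a b p / orient a b c}) := by
    ext p
    exact mem_openTriangle_iff h p
  rw [this]
  unfold orient
  exact (isOpen_lt (by fun_prop) (by fun_prop)).inter
    ((isOpen_lt (by fun_prop) (by fun_prop)).inter (isOpen_lt (by fun_prop) (by fun_prop)))

/-- A connected set that meets an open triangle but none of its sides stays inside. -/
theorem IsPreconnected.subset_openTriangle {a b c : ℝ × ℝ} (h : orient a b c ≠ 0)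
    {C : Set (ℝ × ℝ)} (hC : IsPreconnected C) (hne : (C ∩ openTriangle a b c).Nonempty)
    (hab : Disjoint C (segment ℝ a b)) (hac : Disjoint C (segment ℝ a c))
    (hbc : Disjoint C (segment ℝ b c)) : C ⊆ openTriangle a b c := by
  let f : ℝ × ℝ → ℝ := fun p => orient p b c / orient a b c
  let g : ℝ × ℝ → ℝ := fun p => orient a p c / orient a b c
  let k : ℝ × ℝ → ℝ := fun p => orient a b p / orient a b c
  have hf : Continuous f := by unfold f orient; fun_prop
  have hg : Continuous g := by unfold g orient; fun_prop
  have hk : Continuous k := by unfold k orient; fun_prop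
  have hO : ∀ p, p ∈ openTriangle a b c ↔ 0 < f p ∧ 0 < g p ∧ 0 < k p := mem_openTriangle_iff h
  have hopen : ∀ {e : ℝ × ℝ → ℝ}, Continuous e → IsOpen {p | e p < 0} :=
    fun he => isOpen_lt he continuous_const
  refine hC.subset_left_of_subset_union (u := openTriangle a b c)
    (v := {p | f p < 0} ∪ ({p | g p < 0} ∪ {p | k p < 0})) (isOpen_openTriangle h)
    ((hopen hf).union ((hopen hg).union (hopen hk))) (Set.disjoint_left.2 fun p hp => ?_)
    (fun p hp => ?_) hne
  · obtain ⟨h1, h2, h3⟩ := (hO p).1 hp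
    rintro (h4 | h4 | h4)
    · exact lt_asymm h1 h4
    · exact lt_asymm h2 h4
    · exact lt_asymm h3 h4
  · obtain ⟨h1, h2⟩ := barycentric_eq h p
    change f p + g p + k p = 1 at h1
    change p = f p • a + g p • b + k p • c at h2
    by_contra hcon
    obtain ⟨h3, h4⟩ := not_or.1 hcon
    obtain ⟨h4, h5⟩ := not_or.1 h4
    obtain ⟨h5, h6⟩ := not_or.1 h5
    replace h4 : 0 ≤ f p := not_lt.1 h4
    replace h5 : 0 ≤ g p := not_lt.1 h5
    replace h6 : 0 ≤ k p := not_lt.1 h6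
    rw [hO, not_and_or, not_and_or, not_lt, not_lt, not_lt] at h3
    rcases h3 with h3 | h3 | h3
    · have h0 : f p = 0 := le_antisymm h3 h4
      rw [h0, zero_smul, zero_add] at h2
      exact Set.disjoint_left.1 hbc hp ⟨g p, k p, h5, h6, by linarith, h2.symm⟩
    · have h0 : g p = 0 := le_antisymm h3 h5
      rw [h0, zero_smul, add_zero] at h2
      exact Set.disjoint_left.1 hac hp ⟨f p, k p, h4, h6, by linarith, h2.symm⟩
    · have h0 : k p = 0 := le_antisymm h3 h6
      rw [h0, zero_smul, add_zero] at h2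
      exact Set.disjoint_left.1 hab hp ⟨f p, g p, h4, h5, by linarith, h2.symm⟩

/-- In an outerplane subgraph no triangle with straight sides encloses a vertex. -/
theorem PlaneEmbedding.OuterplaneOn.not_mem_openTriangle {V : Type} {G : SimpleGraph V}
    {E : PlaneEmbedding G} (hE : ∀ ⦃u v⦄ (h : G.Adj u v), E.arc h = segment ℝ (E.vtx u) (E.vtx v))
    {S : Set V} (hS : E.OuterplaneOn S) {x y z d : V} (hx : x ∈ S) (hy : y ∈ S) (hz : z ∈ S)
    (hd : d ∈ S) (hxy : G.Adj x y) (hxz : G.Adj x z) (hyz : G.Adj y z)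
    (ho : orient (E.vtx x) (E.vtx y) (E.vtx z) ≠ 0) :
    E.vtx d ∉ openTriangle (E.vtx x) (E.vtx y) (E.vtx z) := by
  intro hmem
  obtain ⟨p, hpT, hpS, hunb⟩ := mem_closure_iff.1 (hS d hd) _ (isOpen_openTriangle ho) hmem
  refine hunb ?_
  have hside : ∀ {u v : V}, u ∈ S → v ∈ S → G.Adj u v →
      Disjoint (connectedComponentIn (E.subSupport S)ᶜ p) (segment ℝ (E.vtx u) (E.vtx v)) := by
    intro u v hu hv huv
    refine Set.disjoint_left.2 fun r hr hr' => ?_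
    exact connectedComponentIn_subset _ _ hr
      (E.arc_subset_subSupport hu hv huv (hE huv ▸ hr'))
  have hsub := isPreconnected_connectedComponentIn.subset_openTriangle ho
    ⟨p, mem_connectedComponentIn hpS, hpT⟩ (hside hx hy hxy) (hside hx hz hxz) (hside hy hz hyz)
  exact (isBounded_openTriangle _ _ _).subset hsub

/-- The centroid of a triangle. -/
noncomputable def triangleCenter (a b c : ℝ × ℝ) : ℝ × ℝ := (1 / 3 : ℝ) • (a + b + c)

theorem triangleCenter_rotate (a b c : ℝ × ℝ) : triangleCenter a b c = triangleCenter b c a := by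
  unfold triangleCenter
  rw [add_comm (b + c) a, add_assoc]

theorem triangleCenter_swap (a b c : ℝ × ℝ) : triangleCenter a b c = triangleCenter a c b := by
  unfold triangleCenter
  rw [add_right_comm]

theorem triangleCenter_mem_openTriangle (a b c : ℝ × ℝ) :
    triangleCenter a b c ∈ openTriangle a b c :=
  ⟨1 / 3, 1 / 3, 1 / 3, by norm_num, by norm_num, by norm_num, by norm_num, by
    simp only [triangleCenter, smul_add]⟩

/-- The barycentric coordinates of a point in the part of a triangle next to the side `a b`. -/
theorem coords_of_mem_openTriangle_center {a b c p : ℝ × ℝ}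
    (hp : p ∈ openTriangle (triangleCenter a b c) a b) :
    ∃ α β γ : ℝ, α + β + γ = 1 ∧ p = α • a + β • b + γ • c ∧ 0 < γ ∧ γ < α ∧ γ < β := by
  obtain ⟨α, β, γ, hα, hβ, hγ, hs, rfl⟩ := hp
  refine ⟨α / 3 + β, α / 3 + γ, α / 3, by linarith, ?_, by linarith, by linarith, by linarith⟩
  unfold triangleCenter
  module

/-- The barycentric coordinates of a point between the corner `a` and the centroid. -/
theorem coords_of_mem_segment_center {a b c p : ℝ × ℝ}
    (hp : p ∈ segment ℝ (triangleCenter a b c) a) :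
    ∃ α β : ℝ, α + β + β = 1 ∧ p = α • a + β • b + β • c ∧ 0 ≤ β ∧ β ≤ α := by
  obtain ⟨s, t, hs, ht, hst, rfl⟩ := hp
  refine ⟨s / 3 + t, s / 3, by linarith, ?_, by linarith, by linarith⟩
  unfold triangleCenter
  module

theorem openTriangle_rotate (a b c : ℝ × ℝ) : openTriangle a b c = openTriangle b c a := by
  ext p
  constructor
  · rintro ⟨α, β, γ, hα, hβ, hγ, hs, rfl⟩
    exact ⟨β, γ, α, hβ, hγ, hα, by linarith, by module⟩
  · rintro ⟨α, β, γ, hα, hβ, hγ, hs, rfl⟩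
    exact ⟨γ, α, β, hγ, hα, hβ, by linarith, by module⟩

theorem openTriangle_swap (a b c : ℝ × ℝ) : openTriangle a b c = openTriangle a c b := by
  ext p
  constructor <;>
  · rintro ⟨α, β, γ, hα, hβ, hγ, hs, rfl⟩
    exact ⟨α, γ, β, hα, hγ, hβ, by linarith, by module⟩

theorem openTriangle_center_subset (a b c : ℝ × ℝ) :
    openTriangle (triangleCenter a b c) a b ⊆ openTriangle a b c := by
  intro p hp
  obtain ⟨α, β, γ, hs, rfl, h1, h2, h3⟩ := coords_of_mem_openTriangle_center hp
  exact ⟨α, β, γ, by linarith, by linarith, h1, hs, rfl⟩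

theorem openTriangle_center_subset' (a b c : ℝ × ℝ) :
    openTriangle (triangleCenter a b c) a c ⊆ openTriangle a b c := by
  rw [triangleCenter_swap, openTriangle_swap a b c]
  exact openTriangle_center_subset a c b

theorem segment_center_subset (a b c : ℝ × ℝ) :
    segment ℝ (triangleCenter a b c) a ⊆ insert a (openTriangle a b c) := by
  intro p hp
  obtain ⟨α, β, hs, rfl, h1, h2⟩ := coords_of_mem_segment_center hp
  rcases h1.eq_or_lt with rfl | h1
  · left
    obtain rfl : α = 1 := by linarith
    module
  · exact Or.inr ⟨α, β, β, by linarith, h1, h1, hs, rfl⟩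

theorem disjoint_openTriangle_center_segment {a b c : ℝ × ℝ} (h : orient a b c ≠ 0) :
    Disjoint (openTriangle (triangleCenter a b c) a b) (segment ℝ (triangleCenter a b c) a) := by
  refine Set.disjoint_left.2 fun p hp hp' => ?_
  obtain ⟨α, β, γ, hs, hp, h1, h2, h3⟩ := coords_of_mem_openTriangle_center hp
  obtain ⟨α', β', hs', hp', h1', h2'⟩ := coords_of_mem_segment_center hp'
  obtain ⟨e1, e2, e3⟩ := barycentric_unique h hs hs' (hp.symm.trans hp')
  linarith

theorem disjoint_openTriangle_center_segment_opposite {a b c : ℝ × ℝ} (h : orient a b c ≠ 0) :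
    Disjoint (openTriangle (triangleCenter a b c) b c) (segment ℝ (triangleCenter a b c) a) := by
  refine Set.disjoint_left.2 fun p hp hp' => ?_
  rw [triangleCenter_rotate] at hp
  obtain ⟨α, β, γ, hs, hp, h1, h2, h3⟩ := coords_of_mem_openTriangle_center hp
  obtain ⟨α', β', hs', hp', h1', h2'⟩ := coords_of_mem_segment_center hp'
  obtain ⟨e1, e2, e3⟩ := barycentric_unique h (α := γ) (β := α) (γ := β) (by linarith) hs'
    (Eq.trans (by rw [hp]; module) hp')
  linarith

theorem disjoint_openTriangle_center {a b c : ℝ × ℝ} (h : orient a b c ≠ 0) :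
    Disjoint (openTriangle (triangleCenter a b c) a b)
      (openTriangle (triangleCenter a b c) a c) := by
  refine Set.disjoint_left.2 fun p hp hp' => ?_
  rw [triangleCenter_swap] at hp'
  obtain ⟨α, β, γ, hs, hp, h1, h2, h3⟩ := coords_of_mem_openTriangle_center hp
  obtain ⟨α', β', γ', hs', hp', h1', h2', h3'⟩ := coords_of_mem_openTriangle_center hp'
  obtain ⟨e1, e2, e3⟩ := barycentric_unique h (α' := α') (β' := γ') (γ' := β') hs (by linarith)
    (hp.symm.trans (hp'.trans (by module)))
  linarith

theorem eq_center_of_mem_segments {a b c p : ℝ × ℝ} (h : orient a b c ≠ 0)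
    (hp : p ∈ segment ℝ (triangleCenter a b c) a) (hp' : p ∈ segment ℝ (triangleCenter a b c) b) :
    p = triangleCenter a b c := by
  rw [triangleCenter_rotate] at hp'
  obtain ⟨α, β, hs, hp, h1, h2⟩ := coords_of_mem_segment_center hp
  obtain ⟨α', β', hs', hp', h1', h2'⟩ := coords_of_mem_segment_center hp'
  obtain ⟨e1, e2, e3⟩ := barycentric_unique h (α' := β') (β' := α') (γ' := β') hs (by linarith)
    (hp.symm.trans (hp'.trans (by module)))
  obtain rfl : α = 1 / 3 := by linarith
  obtain rfl : β = 1 / 3 := by linarith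
  rw [hp, triangleCenter, smul_add, smul_add]

theorem orient_rotate (a b c : ℝ × ℝ) : orient a b c = orient b c a := by
  unfold orient; ring

theorem orient_swap (a b c : ℝ × ℝ) : orient a b c = - orient a c b := by
  unfold orient; ring

theorem orient_center (a b c : ℝ × ℝ) :
    orient (triangleCenter a b c) a b = orient a b c / 3 := by
  simp only [orient, triangleCenter, Prod.smul_fst, Prod.smul_snd, Prod.fst_add, Prod.snd_add,
    smul_eq_mul]
  ring

theorem disjoint_openTriangle_center_spoke {a b c q : ℝ × ℝ} (h : orient a b c ≠ 0)
    (hq : q = triangleCenter a b c ∨ q = a ∨ q = b ∨ q = c) :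
    Disjoint (openTriangle (triangleCenter a b c) a b)
      (segment ℝ (triangleCenter a b c) q) := by
  rcases hq with rfl | rfl | rfl | rfl
  · refine (disjoint_openTriangle_center_segment h).mono_right ?_
    rw [segment_same, Set.singleton_subset_iff]
    exact left_mem_segment ℝ _ _
  · exact disjoint_openTriangle_center_segment h
  · rw [openTriangle_swap, triangleCenter_rotate, triangleCenter_swap]
    rw [orient_rotate, orient_swap, neg_ne_zero] at h
    exact disjoint_openTriangle_center_segment h
  · rw [triangleCenter_rotate, triangleCenter_rotate]
    rw [orient_rotate, orient_rotate] at h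
    exact disjoint_openTriangle_center_segment_opposite h

theorem segment_center_spoke_subset {a b c q : ℝ × ℝ}
    (hq : q = triangleCenter a b c ∨ q = a ∨ q = b ∨ q = c) :
    segment ℝ (triangleCenter a b c) q ⊆ insert q (openTriangle a b c) := by
  rcases hq with rfl | rfl | rfl | rfl
  · rw [segment_same, Set.singleton_subset_iff]
    exact Set.mem_insert _ _
  · exact segment_center_subset _ _ _
  · rw [triangleCenter_rotate, openTriangle_rotate]
    exact segment_center_subset _ _ _
  · rw [← triangleCenter_rotate, ← openTriangle_rotate]
    exact segment_center_subset _ _ _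

/-- The vertex positions of the straight-line drawing of a stacked graph: every stacked vertex is
placed at the centroid of its parents. -/
noncomputable def stackPos (P : ℕ → ℕ × ℕ × ℕ) (k : ℕ) : ℝ × ℝ :=
  if _h : 3 ≤ k ∧ (P k).1 < k ∧ (P k).2.1 < k ∧ (P k).2.2 < k then
    triangleCenter (stackPos P (P k).1) (stackPos P (P k).2.1) (stackPos P (P k).2.2)
  else if k = 0 then (0, 0) else if k = 1 then (1, 0) else (0, 1)
termination_by k
decreasing_by
  · exact _h.2.1
  · exact _h.2.2.1
  · exact _h.2.2.2

/-- The triangle `T` is an inner face after stacking the vertices `3, …, n + 2`. -/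
def IsStackFace (P : ℕ → ℕ × ℕ × ℕ) : ℕ → ℕ × ℕ × ℕ → Prop
  | 0, T => T = (2, 0, 1)
  | n + 1, T => (IsStackFace P n T ∧ T ≠ P (n + 3)) ∨
      T = (n + 3, (P (n + 3)).1, (P (n + 3)).2.1) ∨
      T = (n + 3, (P (n + 3)).1, (P (n + 3)).2.2) ∨
      T = (n + 3, (P (n + 3)).2.1, (P (n + 3)).2.2)

theorem stackGraph_adj_of_parent {P : ℕ → ℕ × ℕ × ℕ} {i j : ℕ} (hij : i < j)
    (h : i = (P j).1 ∨ i = (P j).2.1 ∨ i = (P j).2.2) : (stackGraph P).Adj j i :=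
  Or.inr ⟨hij, Or.inr h⟩

theorem IsStackFace.lt_and_adj {P : ℕ → ℕ × ℕ × ℕ} (hP : ∀ n, IsStackFace P n (P (n + 3)))
    {n : ℕ} {T : ℕ × ℕ × ℕ} (hT : IsStackFace P n T) :
    T.1 < n + 3 ∧ T.2.1 < n + 3 ∧ T.2.2 < n + 3 ∧ (stackGraph P).Adj T.1 T.2.1 ∧
      (stackGraph P).Adj T.1 T.2.2 ∧ (stackGraph P).Adj T.2.1 T.2.2 := by
  induction n generalizing T with
  | zero =>
    obtain rfl : T = (2, 0, 1) := hT
    refine ⟨by norm_num, by norm_num, by norm_num, ?_, ?_, ?_⟩ <;> simp [stackGraph, IsStackParent]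
  | succ n ih =>
    obtain ⟨l1, l2, l3, a12, a13, a23⟩ := ih (hP n)
    rcases hT with ⟨hT, -⟩ | rfl | rfl | rfl
    · obtain ⟨k1, k2, k3, h⟩ := ih hT
      exact ⟨by omega, by omega, by omega, h⟩
    · exact ⟨by simp, by simp; omega, by simp; omega, stackGraph_adj_of_parent l1 (by simp),
        stackGraph_adj_of_parent l2 (by simp), a12⟩
    · exact ⟨by simp, by simp; omega, by simp; omega, stackGraph_adj_of_parent l1 (by simp),
        stackGraph_adj_of_parent l3 (by simp), a13⟩
    · exact ⟨by simp, by simp; omega, by simp; omega, stackGraph_adj_of_parent l2 (by simp),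
        stackGraph_adj_of_parent l3 (by simp), a23⟩

theorem isStacking_of_isStackFace {P : ℕ → ℕ × ℕ × ℕ} (hP : ∀ n, IsStackFace P n (P (n + 3))) :
    IsStacking P := by
  intro j hj
  obtain ⟨n, rfl⟩ := Nat.exists_eq_add_of_le' hj
  exact (hP n).lt_and_adj hP

theorem IsStacking.stackPos_eq {P : ℕ → ℕ × ℕ × ℕ} (hP : IsStacking P) {j : ℕ} (hj : 3 ≤ j) :
    stackPos P j =
      triangleCenter (stackPos P (P j).1) (stackPos P (P j).2.1) (stackPos P (P j).2.2) := by
  obtain ⟨h1, h2, h3, -⟩ := hP j hj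
  rw [stackPos, dif_pos ⟨hj, h1, h2, h3⟩]

/-- The segment drawn for an edge, or the point drawn for a loop. -/
def edgeSegment (f : ℕ → ℝ × ℝ) : Sym2 ℕ → Set (ℝ × ℝ) :=
  Sym2.lift ⟨fun i j => segment ℝ (f i) (f j), fun i j => segment_symm ℝ (f i) (f j)⟩

/-- The vertices (as loops) and the edges among the first `k` vertices of a stacked graph. -/
def stackCells (P : ℕ → ℕ × ℕ × ℕ) (k : ℕ) : Set (Sym2 ℕ) :=
  {e | ∃ i j, i < k ∧ j < k ∧ (i = j ∨ (stackGraph P).Adj i j) ∧ e = s(i, j)}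

theorem mem_stackCells_succ {P : ℕ → ℕ × ℕ × ℕ} {k : ℕ} (hk : 3 ≤ k) {e : Sym2 ℕ}
    (he : e ∈ stackCells P (k + 1)) : e ∈ stackCells P k ∨
      ∃ q, (q = k ∨ q < k ∧ (q = (P k).1 ∨ q = (P k).2.1 ∨ q = (P k).2.2)) ∧ e = s(k, q) := by
  obtain ⟨i, j, hi, hj, hij, rfl⟩ := he
  have spoke : ∀ m, (stackGraph P).Adj m k → m < k →
      m < k ∧ (m = (P k).1 ∨ m = (P k).2.1 ∨ m = (P k).2.2) := by
    rintro m (h | h) hm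
    · exact ⟨hm, h.2.resolve_left (by omega)⟩
    · exact absurd h.1 (by omega)
  rcases Nat.lt_succ_iff_lt_or_eq.1 hi with hi | rfl
  · rcases Nat.lt_succ_iff_lt_or_eq.1 hj with hj | rfl
    · exact Or.inl ⟨i, j, hi, hj, hij, rfl⟩
    · exact Or.inr ⟨i, Or.inr (spoke i (hij.resolve_left hi.ne) hi), Sym2.eq_swap⟩
  · rcases Nat.lt_succ_iff_lt_or_eq.1 hj with hj | rfl
    · exact Or.inr ⟨j, Or.inr (spoke j (hij.resolve_left hj.ne').symm hj), rfl⟩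
    · exact Or.inr ⟨j, Or.inl rfl, rfl⟩

/-- The open triangle drawn for a triple of vertices. -/
def faceTriangle (f : ℕ → ℝ × ℝ) (T : ℕ × ℕ × ℕ) : Set (ℝ × ℝ) :=
  openTriangle (f T.1) (f T.2.1) (f T.2.2)

/-- After stacking the vertices `3, …, n + 2`, the positions `f` give a straight-line drawing
whose inner faces are nondegenerate, pairwise disjoint and free of vertices and edges. -/
structure IsStackDrawing (P : ℕ → ℕ × ℕ × ℕ) (f : ℕ → ℝ × ℝ) (n : ℕ) : Prop where
  orient_ne : ∀ T, IsStackFace P n T → orient (f T.1) (f T.2.1) (f T.2.2) ≠ 0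
  face_cell : ∀ T, IsStackFace P n T → ∀ e ∈ stackCells P (n + 3),
    Disjoint (faceTriangle f T) (edgeSegment f e)
  face_face : ∀ T T', IsStackFace P n T → IsStackFace P n T' → T ≠ T' →
    Disjoint (faceTriangle f T) (faceTriangle f T')
  cell_cell : ∀ e ∈ stackCells P (n + 3), ∀ e' ∈ stackCells P (n + 3), e ≠ e' →
    ∀ p ∈ edgeSegment f e, p ∈ edgeSegment f e' → ∃ m, m ∈ e ∧ m ∈ e' ∧ p = f m

theorem isStackDrawing_zero (P : ℕ → ℕ × ℕ × ℕ) : IsStackDrawing P (stackPos P) 0 := by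
  have p0 : stackPos P 0 = (0, 0) := by rw [stackPos]; simp
  have p1 : stackPos P 1 = (1, 0) := by rw [stackPos]; simp
  have p2 : stackPos P 2 = (0, 1) := by rw [stackPos]; simp
  have cells : ∀ e ∈ stackCells P 3, e = s(0, 0) ∨ e = s(1, 1) ∨ e = s(2, 2) ∨ e = s(0, 1) ∨
      e = s(0, 2) ∨ e = s(1, 2) := by
    rintro e ⟨i, j, hi, hj, -, rfl⟩
    interval_cases i <;> interval_cases j <;> simp
  have coords : ∀ e ∈ stackCells P 3, ∀ p ∈ edgeSegment (stackPos P) e,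
      (0 ∉ e → p.1 + p.2 = 1) ∧ (1 ∉ e → p.1 = 0) ∧ (2 ∉ e → p.2 = 0) := by
    intro e he p hp
    rcases cells e he with rfl | rfl | rfl | rfl | rfl | rfl <;>
      obtain ⟨s, t, hs, ht, hst, rfl⟩ := hp <;> simp [p0, p1, p2, hst]
  refine ⟨?_, ?_, ?_, ?_⟩
  · rintro T rfl
    simp [p0, p1, p2, orient]
  · rintro T rfl e he
    refine Set.disjoint_left.2 ?_
    rintro p ⟨α, β, γ, hα, hβ, hγ, hs, rfl⟩ hp
    have := coords e he _ hp
    simp only [p0, p1, p2] at this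
    rcases cells e he with rfl | rfl | rfl | rfl | rfl | rfl <;> simp at this <;> linarith
  · rintro T T' rfl rfl h
    exact absurd rfl h
  · intro e he e' he' hne p hp hp'
    have c := coords e he p hp
    have c' := coords e' he' p hp'
    have m0 : p.1 = 0 → p.2 = 0 → p = stackPos P 0 :=
      fun h h' => (Prod.ext h h').trans p0.symm
    have m1 : p.1 = 1 → p.2 = 0 → p = stackPos P 1 :=
      fun h h' => (Prod.ext h h').trans p1.symm
    have m2 : p.1 = 0 → p.2 = 1 → p = stackPos P 2 :=
      fun h h' => (Prod.ext h h').trans p2.symm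
    rcases cells e he with rfl | rfl | rfl | rfl | rfl | rfl <;>
      rcases cells e' he' with rfl | rfl | rfl | rfl | rfl | rfl <;>
      first
      | exact absurd rfl hne
      | (simp at c c'
         first
         | (exfalso; linarith)
         | exact ⟨0, by simp, by simp, m0 (by linarith) (by linarith)⟩
         | exact ⟨1, by simp, by simp, m1 (by linarith) (by linarith)⟩
         | exact ⟨2, by simp, by simp, m2 (by linarith) (by linarith)⟩)

theorem IsStackDrawing.succ {P : ℕ → ℕ × ℕ × ℕ} (hP : ∀ n, IsStackFace P n (P (n + 3))) {n : ℕ}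
    (ih : IsStackDrawing P (stackPos P) n) : IsStackDrawing P (stackPos P) (n + 1) := by
  have hcen := (isStacking_of_isStackFace hP).stackPos_eq (Nat.le_add_left 3 n)
  have hlt := (hP n).lt_and_adj hP
  have hor := ih.orient_ne _ (hP n)
  have hface := hP n
  set f := stackPos P
  have faces : ∀ T, IsStackFace P (n + 1) T → (IsStackFace P n T ∧ T ≠ P (n + 3)) ∨
      T = (n + 3, (P (n + 3)).1, (P (n + 3)).2.1) ∨ T = (n + 3, (P (n + 3)).1, (P (n + 3)).2.2) ∨
      T = (n + 3, (P (n + 3)).2.1, (P (n + 3)).2.2) := fun T h => h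
  have cells : ∀ e ∈ stackCells P (n + 1 + 3), e ∈ stackCells P (n + 3) ∨ _ :=
    fun e he => mem_stackCells_succ (Nat.le_add_left 3 n) he
  generalize P (n + 3) = T₀ at hcen hlt hor hface faces cells
  obtain ⟨x, y, z⟩ := T₀
  simp only at hcen hlt hor faces cells
  obtain ⟨lx, ly, lz, -⟩ := hlt
  have hor' : orient (f x) (f z) (f y) ≠ 0 := by rwa [orient_swap, neg_ne_zero]
  have hor'' : orient (f y) (f z) (f x) ≠ 0 := by rwa [← orient_rotate]
  have hcen' := hcen.trans (triangleCenter_swap _ _ _)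
  have hcen'' := hcen.trans (triangleCenter_rotate _ _ _)
  have spoke_pos : ∀ {q : ℕ}, (q = n + 3 ∨ q < n + 3 ∧ (q = x ∨ q = y ∨ q = z)) →
      (f q = f (n + 3) ∨ f q = f x ∨ f q = f y ∨ f q = f z) := by
    rintro q (rfl | ⟨-, rfl | rfl | rfl⟩) <;> simp
  have spoke_subset : ∀ {q : ℕ} {p : ℝ × ℝ}, (q = n + 3 ∨ q < n + 3 ∧ (q = x ∨ q = y ∨ q = z)) →
      p ∈ segment ℝ (f (n + 3)) (f q) → (q < n + 3 ∧ p = f q) ∨ p ∈ faceTriangle f (x, y, z) := by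
    intro q p hq hp
    have hp' : p = f q ∨ p ∈ faceTriangle f (x, y, z) := by
      have := spoke_pos hq
      rw [hcen] at this hp
      exact segment_center_spoke_subset this hp
    rcases hq with rfl | hq
    · rcases hp' with rfl | hp'
      · exact Or.inr (hcen ▸ triangleCenter_mem_openTriangle _ _ _)
      · exact Or.inr hp'
    · exact hp'.imp_left fun h => ⟨hq.1, h⟩
  have new_face : ∀ {T}, (T = (n + 3, x, y) ∨ T = (n + 3, x, z) ∨ T = (n + 3, y, z)) →
      orient (f T.1) (f T.2.1) (f T.2.2) ≠ 0 ∧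
      faceTriangle f T ⊆ faceTriangle f (x, y, z) ∧
      ∀ q, (f q = f (n + 3) ∨ f q = f x ∨ f q = f y ∨ f q = f z) →
        Disjoint (faceTriangle f T) (segment ℝ (f (n + 3)) (f q)) := by
    rintro T (rfl | rfl | rfl)
    · simp only [faceTriangle]
      rw [hcen, orient_center]
      exact ⟨by simpa using hor, openTriangle_center_subset _ _ _,
        fun q hq => disjoint_openTriangle_center_spoke hor hq⟩
    · simp only [faceTriangle]
      rw [openTriangle_swap (f x), hcen', orient_center]
      exact ⟨by simpa using hor', openTriangle_center_subset _ _ _,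
        fun q hq => disjoint_openTriangle_center_spoke hor' (by tauto)⟩
    · simp only [faceTriangle]
      rw [openTriangle_rotate (f x), hcen'', orient_center]
      exact ⟨by simpa using hor'', openTriangle_center_subset _ _ _,
        fun q hq => disjoint_openTriangle_center_spoke hor'' (by tauto)⟩
  have old_cell : ∀ m < n + 3, s(m, m) ∈ stackCells P (n + 3) :=
    fun m hm => ⟨m, m, hm, hm, Or.inl rfl, rfl⟩
  refine ⟨fun T hT => ?_, fun T hT e he => ?_, fun T T' hT hT' hne => ?_, ?_⟩
  · rcases faces T hT with hT | hT
    · exact ih.orient_ne T hT.1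
    · exact (new_face hT).1
  · rcases faces T hT with hT | hT
    · rcases cells e he with he | ⟨q, hq, rfl⟩
      · exact ih.face_cell T hT.1 e he
      · refine Set.disjoint_left.2 fun p hp hp' => ?_
        rcases spoke_subset hq hp' with ⟨hlt, rfl⟩ | hp'
        · exact Set.disjoint_left.1 (ih.face_cell T hT.1 _ (old_cell q hlt)) hp
            (left_mem_segment ℝ _ _)
        · exact Set.disjoint_left.1 (ih.face_face T _ hT.1 hface hT.2) hp hp'
    · rcases cells e he with he | ⟨q, hq, rfl⟩
      · exact (ih.face_cell _ hface e he).mono_left (new_face hT).2.1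
      · exact (new_face hT).2.2 q (spoke_pos hq)
  · rcases faces T hT with hT | hT <;> rcases faces T' hT' with hT' | hT'
    · exact ih.face_face T T' hT.1 hT'.1 hne
    · exact (ih.face_face T _ hT.1 hface hT.2).mono_right (new_face hT').2.1
    · exact (ih.face_face T' _ hT'.1 hface hT'.2).symm.mono_left (new_face hT).2.1
    · have dx : Disjoint (faceTriangle f (n + 3, x, y)) (faceTriangle f (n + 3, x, z)) := by
        simp only [faceTriangle, hcen]
        exact disjoint_openTriangle_center hor
      have dy : Disjoint (faceTriangle f (n + 3, x, y)) (faceTriangle f (n + 3, y, z)) := by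
        simp only [faceTriangle, hcen'']
        rw [openTriangle_swap _ (f x), disjoint_comm]
        exact disjoint_openTriangle_center hor''
      have dz : Disjoint (faceTriangle f (n + 3, x, z)) (faceTriangle f (n + 3, y, z)) := by
        simp only [faceTriangle, hcen''.trans (triangleCenter_rotate _ _ _)]
        rw [openTriangle_swap _ (f x), openTriangle_swap _ (f y)]
        exact disjoint_openTriangle_center (by rwa [← orient_rotate])
      rcases hT with rfl | rfl | rfl <;> rcases hT' with rfl | rfl | rfl
      · exact absurd rfl hne
      · exact dx
      · exact dy
      · exact dx.symm
      · exact absurd rfl hne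
      · exact dz
      · exact dy.symm
      · exact dz.symm
      · exact absurd rfl hne
  · have mixed : ∀ e ∈ stackCells P (n + 3), ∀ q,
        (q = n + 3 ∨ q < n + 3 ∧ (q = x ∨ q = y ∨ q = z)) → ∀ p ∈ edgeSegment f e,
        p ∈ segment ℝ (f (n + 3)) (f q) → ∃ m, m ∈ e ∧ m ∈ s(n + 3, q) ∧ p = f m := by
      intro e he q hq p hp hp'
      rcases spoke_subset hq hp' with ⟨hlt, rfl⟩ | hp'
      · refine ⟨q, ?_, by simp, rfl⟩
        by_cases hqe : s(q, q) = e
        · simp [← hqe]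
        · obtain ⟨m, hm, hm', -⟩ :=
            ih.cell_cell _ (old_cell q hlt) e he hqe _ (left_mem_segment ℝ _ _) hp
          obtain rfl : m = q := by simpa using hm
          exact hm'
      · exact absurd hp (Set.disjoint_left.1 (ih.face_cell _ hface e he) hp')
    have meet : ∀ q q', (q = n + 3 ∨ q < n + 3 ∧ (q = x ∨ q = y ∨ q = z)) →
        (q' = n + 3 ∨ q' < n + 3 ∧ (q' = x ∨ q' = y ∨ q' = z)) → q ≠ q' →
        ∀ p ∈ segment ℝ (f (n + 3)) (f q), p ∈ segment ℝ (f (n + 3)) (f q') →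
        p = f (n + 3) := by
      have mxy : ∀ p ∈ segment ℝ (f (n + 3)) (f x), p ∈ segment ℝ (f (n + 3)) (f y) →
          p = f (n + 3) := by
        rw [hcen]
        exact fun p => eq_center_of_mem_segments hor
      have mxz : ∀ p ∈ segment ℝ (f (n + 3)) (f x), p ∈ segment ℝ (f (n + 3)) (f z) →
          p = f (n + 3) := by
        rw [hcen']
        exact fun p => eq_center_of_mem_segments hor'
      have myz : ∀ p ∈ segment ℝ (f (n + 3)) (f y), p ∈ segment ℝ (f (n + 3)) (f z) →
          p = f (n + 3) := by
        rw [hcen'']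
        exact fun p => eq_center_of_mem_segments hor''
      rintro q q' (rfl | ⟨-, hq⟩) hq' hne p hp hp'
      · simpa using hp
      rcases hq' with rfl | ⟨-, hq'⟩
      · simpa using hp'
      rcases hq with rfl | rfl | rfl <;> rcases hq' with rfl | rfl | rfl
      · exact absurd rfl hne
      · exact mxy p hp hp'
      · exact mxz p hp hp'
      · exact mxy p hp' hp
      · exact absurd rfl hne
      · exact myz p hp hp'
      · exact mxz p hp' hp
      · exact myz p hp' hp
      · exact absurd rfl hne
    intro e he e' he' hne p hp hp'
    rcases cells e he with he | ⟨q, hq, rfl⟩ <;> rcases cells e' he' with he' | ⟨q', hq', rfl⟩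
    · exact ih.cell_cell e he e' he' hne p hp hp'
    · exact mixed e he q' hq' p hp hp'
    · obtain ⟨m, hm, hm', h⟩ := mixed e' he' q hq p hp' hp
      exact ⟨m, hm', hm, h⟩
    · exact ⟨n + 3, by simp, by simp,
        meet q q' hq hq' (fun h => hne (by rw [h])) p hp hp'⟩

theorem isStackDrawing_stackPos {P : ℕ → ℕ × ℕ × ℕ} (hP : ∀ n, IsStackFace P n (P (n + 3)))
    (n : ℕ) : IsStackDrawing P (stackPos P) n := by
  induction n with
  | zero => exact isStackDrawing_zero P
  | succ n ih => exact ih.succ hP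

/-- The straight-line embedding of a stacked graph. -/
noncomputable def stackEmbedding {P : ℕ → ℕ × ℕ × ℕ} (hP : ∀ n, IsStackFace P n (P (n + 3)))
    (N : ℕ) : PlaneEmbedding (finStackGraph P N) :=
  PlaneEmbedding.straightLine (fun i => stackPos P i) fun u v a b huv hab hne p hp hp' => by
    have cell : ∀ i j : Fin N, (i = j ∨ (finStackGraph P N).Adj i j) →
        s((i : ℕ), (j : ℕ)) ∈ stackCells P (N + 3) := fun i j hij =>
      ⟨i, j, by omega, by omega, hij.imp_left (congr_arg Fin.val), rfl⟩
    have hne' : s((u : ℕ), (v : ℕ)) ≠ s((a : ℕ), (b : ℕ)) := fun h =>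
      hne (Sym2.map.injective Fin.val_injective h)
    obtain ⟨m, hm, hm', h⟩ := (isStackDrawing_stackPos hP N).cell_cell _ (cell u v huv) _
      (cell a b hab) hne' p hp hp'
    rw [Sym2.mem_iff] at hm hm'
    have hmN : m < N := by omega
    exact ⟨⟨m, hmN⟩, by simpa [Fin.ext_iff] using hm, by simpa [Fin.ext_iff] using hm', h⟩

/-- An outerplane induced subgraph containing a triangle that was once a face contains no vertex
stacked inside it. -/
theorem not_mem_faceTriangle_of_outerplaneOn {P : ℕ → ℕ × ℕ × ℕ}
    (hP : ∀ n, IsStackFace P n (P (n + 3))) {N : ℕ} {S : Finset (Fin N)}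
    (hS : (stackEmbedding hP N).OuterplaneOn ↑S) {n : ℕ} {T : ℕ × ℕ × ℕ}
    (hT : IsStackFace P n T) (h₁ : T.1 ∈ S.image Fin.val) (h₂ : T.2.1 ∈ S.image Fin.val)
    (h₃ : T.2.2 ∈ S.image Fin.val) {d : ℕ} (hd : d ∈ S.image Fin.val) :
    stackPos P d ∉ faceTriangle (stackPos P) T := by
  obtain ⟨T₁, T₂, T₃⟩ := T
  obtain ⟨-, -, -, d12, d13, d23⟩ := hT.lt_and_adj hP
  have hor := (isStackDrawing_stackPos hP n).orient_ne _ hT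
  obtain ⟨x, hx, rfl⟩ := Finset.mem_image.1 h₁
  obtain ⟨y, hy, rfl⟩ := Finset.mem_image.1 h₂
  obtain ⟨z, hz, rfl⟩ := Finset.mem_image.1 h₃
  obtain ⟨w, hw, rfl⟩ := Finset.mem_image.1 hd
  exact hS.not_mem_openTriangle (fun _ _ _ => rfl) hx hy hz hw d12 d13 d23 hor

/-- The parents of the vertices of a chain of blocks `a, b, c, d, e, f, g` of seven vertices.
The vertex `a` is stacked onto the vertices `0`, `1` and the vertex `a` of the preceding block
(or onto `2`). -/
def blockParents (j : ℕ) : ℕ × ℕ × ℕ :=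
  match (j - 3) % 7 with
  | 0 => (max 2 (j - 7), 0, 1)
  | 1 => (j - 1, max 2 (j - 8), 0)
  | 2 => (j - 1, j - 2, 0)
  | 3 => (j - 1, j - 2, j - 3)
  | 4 => (j - 1, j - 2, j - 4)
  | 5 => (j - 2, j - 3, j - 4)
  | _ => (j - 1, j - 3, j - 5)

theorem blockParents_a (i : ℕ) : blockParents (7 * i + 3) = (max 2 (7 * i - 4), 0, 1) := by
  have h : (7 * i + 3 - 3) % 7 = 0 := by omega
  simp only [blockParents, h, Prod.mk.injEq, and_true]
  omega

theorem blockParents_b (i : ℕ) :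
    blockParents (7 * i + 4) = (7 * i + 3, max 2 (7 * i - 4), 0) := by
  have h : (7 * i + 4 - 3) % 7 = 1 := by omega
  simp only [blockParents, h, Prod.mk.injEq, and_true]
  omega

theorem blockParents_c (i : ℕ) : blockParents (7 * i + 5) = (7 * i + 4, 7 * i + 3, 0) := by
  have h : (7 * i + 5 - 3) % 7 = 2 := by omega
  simp only [blockParents, h, Prod.mk.injEq, and_true]
  omega

theorem blockParents_d (i : ℕ) :
    blockParents (7 * i + 6) = (7 * i + 5, 7 * i + 4, 7 * i + 3) := by
  have h : (7 * i + 6 - 3) % 7 = 3 := by omega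
  simp only [blockParents, h, Prod.mk.injEq]
  omega

theorem blockParents_e (i : ℕ) :
    blockParents (7 * i + 7) = (7 * i + 6, 7 * i + 5, 7 * i + 3) := by
  have h : (7 * i + 7 - 3) % 7 = 4 := by omega
  simp only [blockParents, h, Prod.mk.injEq]
  omega

theorem blockParents_f (i : ℕ) :
    blockParents (7 * i + 8) = (7 * i + 6, 7 * i + 5, 7 * i + 4) := by
  have h : (7 * i + 8 - 3) % 7 = 5 := by omega
  simp only [blockParents, h, Prod.mk.injEq]
  omega

theorem blockParents_g (i : ℕ) :
    blockParents (7 * i + 9) = (7 * i + 8, 7 * i + 6, 7 * i + 4) := by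
  have h : (7 * i + 9 - 3) % 7 = 6 := by omega
  simp only [blockParents, h, Prod.mk.injEq]
  omega

theorem isStackFace_block {i : ℕ} (h : IsStackFace blockParents (7 * i) (max 2 (7 * i - 4), 0, 1)) :
    (∀ r < 7, IsStackFace blockParents (7 * i + r) (blockParents (7 * i + r + 3))) ∧
      IsStackFace blockParents (7 * (i + 1)) (max 2 (7 * (i + 1) - 4), 0, 1) := by
  have ha := blockParents_a i
  have hb := blockParents_b i
  have hc := blockParents_c i
  have hd := blockParents_d i
  have he := blockParents_e i
  have hf := blockParents_f i
  have hg := blockParents_g i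
  have stay : ∀ {n T}, IsStackFace blockParents n T → T ≠ blockParents (n + 3) →
      IsStackFace blockParents (n + 1) T := fun h h' => Or.inl ⟨h, h'⟩
  have a1 : IsStackFace blockParents (7 * i + 1) (7 * i + 3, 0, 1) := by
    simp [IsStackFace, ha]
  have b1 : IsStackFace blockParents (7 * i + 1) (7 * i + 3, max 2 (7 * i - 4), 0) := by
    simp [IsStackFace, ha]
  have c1 : IsStackFace blockParents (7 * i + 2) (7 * i + 4, 7 * i + 3, 0) := by
    simp [IsStackFace, hb]
  have d1 : IsStackFace blockParents (7 * i + 3) (7 * i + 5, 7 * i + 4, 7 * i + 3) := by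
    simp [IsStackFace, hc]
  have e1 : IsStackFace blockParents (7 * i + 4) (7 * i + 6, 7 * i + 5, 7 * i + 3) := by
    simp [IsStackFace, hd]
  have f1 : IsStackFace blockParents (7 * i + 4) (7 * i + 6, 7 * i + 5, 7 * i + 4) := by
    simp [IsStackFace, hd]
  have f2 := stay f1 (by rw [he]; simp)
  have g1 : IsStackFace blockParents (7 * i + 6) (7 * i + 8, 7 * i + 6, 7 * i + 4) := by
    simp [IsStackFace, hf]
  have a2 := stay a1 (by rw [hb]; simp)
  have a3 := stay a2 (by rw [hc]; simp)
  have a4 := stay a3 (by rw [hd]; simp)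
  have a5 := stay a4 (by rw [he]; simp)
  have a6 := stay a5 (by rw [hf]; simp)
  have a7 := stay a6 (by rw [hg]; simp)
  refine ⟨fun r hr => ?_, ?_⟩
  · interval_cases r
    · exact ha ▸ h
    · exact hb ▸ b1
    · exact hc ▸ c1
    · exact hd ▸ d1
    · exact he ▸ e1
    · exact hf ▸ f2
    · exact hg ▸ g1
  · have : max 2 (7 * (i + 1) - 4) = 7 * i + 3 := by omega
    rw [this]
    exact a7

theorem isStackFace_blockParents (n : ℕ) : IsStackFace blockParents n (blockParents (n + 3)) := by
  have start : ∀ i, IsStackFace blockParents (7 * i) (max 2 (7 * i - 4), 0, 1) := by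
    intro i
    induction i with
    | zero => rfl
    | succ i ih => exact (isStackFace_block ih).2
  have := (isStackFace_block (start (n / 7))).1 (n % 7) (Nat.mod_lt _ (by norm_num))
  rwa [Nat.div_add_mod] at this

/-- An outerplane induced subgraph misses two vertices of every block. -/
theorem exists_two_not_mem_block {N : ℕ} {S : Finset (Fin N)}
    (hS : (stackEmbedding isStackFace_blockParents N).OuterplaneOn ↑S) (i : ℕ) :
    ∃ u ∈ Finset.Ico (7 * i + 3) (7 * i + 10), ∃ v ∈ Finset.Ico (7 * i + 3) (7 * i + 10),
      u ≠ v ∧ u ∉ S.image Fin.val ∧ v ∉ S.image Fin.val := by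
  have hP := isStackFace_blockParents
  have center := fun j : ℕ =>
    (isStacking_of_isStackFace hP).stackPos_eq (Nat.le_add_left 3 j)
  have hself : ∀ j, stackPos blockParents (j + 3) ∈
      faceTriangle (stackPos blockParents) (blockParents (j + 3)) := fun j => by
    rw [center]
    exact triangleCenter_mem_openTriangle _ _ _
  have hd := hself (7 * i + 3)
  have he := hself (7 * i + 4)
  have hf := hself (7 * i + 5)
  have hg := hself (7 * i + 6)
  have fd := hP (7 * i + 3)
  have fe := hP (7 * i + 4)
  have ff := hP (7 * i + 5)
  have fg := hP (7 * i + 6)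
  have cd := center (7 * i + 3)
  simp only [Nat.add_assoc, Nat.reduceAdd] at hd he hf hg fd fe ff fg cd
  rw [blockParents_d] at hd fd cd
  rw [blockParents_e] at he fe
  rw [blockParents_f] at hf ff
  rw [blockParents_g] at hg fg
  have he' : stackPos blockParents (7 * i + 7) ∈
      faceTriangle (stackPos blockParents) (7 * i + 5, 7 * i + 4, 7 * i + 3) := by
    simp only [faceTriangle, cd] at he ⊢
    exact openTriangle_center_subset' _ _ _ he
  have key := @not_mem_faceTriangle_of_outerplaneOn _ hP N S hS
  have kd := fun h₁ h₂ h₃ h₄ => key fd h₁ h₂ h₃ h₄ hd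
  have ke' := fun h₁ h₂ h₃ h₄ => key fd h₁ h₂ h₃ h₄ he'
  have ke := fun h₁ h₂ h₃ h₄ => key fe h₁ h₂ h₃ h₄ he
  have kf := fun h₁ h₂ h₃ h₄ => key ff h₁ h₂ h₃ h₄ hf
  have kg := fun h₁ h₂ h₃ h₄ => key fg h₁ h₂ h₃ h₄ hg
  simp only at kd ke' ke kf kg
  by_contra! hcon
  have pair : ∀ r < 7, ∀ r' < 7, r ≠ r' → 7 * i + (3 + r) ∉ S.image Fin.val →
      7 * i + (3 + r') ∈ S.image Fin.val := fun r hr r' hr' hne =>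
    hcon _ (Finset.mem_Ico.2 ⟨by omega, by omega⟩) _ (Finset.mem_Ico.2 ⟨by omega, by omega⟩)
      (by omega)
  by_cases ma : 7 * i + 3 ∈ S.image Fin.val
  · by_cases mb : 7 * i + 4 ∈ S.image Fin.val
    · by_cases mc : 7 * i + 5 ∈ S.image Fin.val
      · by_cases md : 7 * i + 6 ∈ S.image Fin.val
        · exact kd mc mb ma md
        · exact ke' mc mb ma
            (pair 3 (by norm_num) 4 (by norm_num) (by norm_num) md)
      · have := fun r hr hne => pair 2 (by norm_num) r hr hne mc
        exact kg (this 5 (by norm_num) (by norm_num)) (this 3 (by norm_num) (by norm_num)) mb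
          (this 6 (by norm_num) (by norm_num))
    · have := fun r hr hne => pair 1 (by norm_num) r hr hne mb
      exact ke (this 3 (by norm_num) (by norm_num)) (this 2 (by norm_num) (by norm_num)) ma
        (this 4 (by norm_num) (by norm_num))
  · have := fun r hr hne => pair 0 (by norm_num) r hr hne ma
    exact kf (this 3 (by norm_num) (by norm_num)) (this 2 (by norm_num) (by norm_num))
      (this 1 (by norm_num) (by norm_num)) (this 5 (by norm_num) (by norm_num))

theorem card_filter_le_of_block {S : Finset ℕ}
    (hS : ∀ i, ∃ u ∈ Finset.Ico (7 * i + 3) (7 * i + 10),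
      ∃ v ∈ Finset.Ico (7 * i + 3) (7 * i + 10), u ≠ v ∧ u ∉ S ∧ v ∉ S) (n : ℕ) :
    (S.filter (· < 7 * n + 3)).card ≤ 5 * n + 3 := by
  induction n with
  | zero =>
    refine (Finset.card_le_card (t := Finset.range 3) fun m hm => ?_).trans (by simp)
    simpa using (Finset.mem_filter.1 hm).2
  | succ n ih =>
    obtain ⟨u, hu, v, hv, huv, hu', hv'⟩ := hS n
    have hsub : S.filter (· < 7 * (n + 1) + 3) ⊆ S.filter (· < 7 * n + 3) ∪
        ((Finset.Ico (7 * n + 3) (7 * n + 10)).erase u).erase v := by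
      intro m hm
      rw [Finset.mem_filter] at hm
      rw [Finset.mem_union, Finset.mem_filter, Finset.mem_erase, Finset.mem_erase, Finset.mem_Ico]
      rcases lt_or_ge m (7 * n + 3) with h | h
      · exact Or.inl ⟨hm.1, h⟩
      · exact Or.inr ⟨fun e => hv' (e ▸ hm.1), fun e => hu' (e ▸ hm.1), h, by omega⟩
    have hcard : (((Finset.Ico (7 * n + 3) (7 * n + 10)).erase u).erase v).card = 5 := by
      rw [Finset.card_erase_of_mem (Finset.mem_erase.2 ⟨huv.symm, hv⟩),
        Finset.card_erase_of_mem hu, Nat.card_Ico]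
      omega
    have := (Finset.card_le_card hsub).trans (Finset.card_union_le _ _)
    omega

theorem sO'_stackEmbedding_le (n : ℕ) :
    sO' (stackEmbedding isStackFace_blockParents (7 * n + 3)) ≤ 5 * n + 3 := by
  refine csSup_le ⟨0, ∅, by simp [PlaneEmbedding.OuterplaneOn], rfl⟩ ?_
  rintro _ ⟨S, hS, rfl⟩
  rw [← Finset.card_image_of_injective S Fin.val_injective]
  refine le_trans (Finset.card_le_card fun m hm => ?_)
    (card_filter_le_of_block (exists_two_not_mem_block hS) n)
  obtain ⟨k, -, rfl⟩ := Finset.mem_image.1 hm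
  exact Finset.mem_filter.2 ⟨hm, k.2⟩

/-- The position of a vertex other than the vertices `d` in an outerplanar vertex order. -/
def blockOrder (j : ℕ) : ℕ :=
  6 * ((j - 3) / 7) + match (j - 3) % 7 with
  | 0 => 5
  | 1 => 0
  | 2 => 3
  | 4 => 4
  | 5 => 2
  | _ => 1

theorem exists_blockOrder {j : ℕ} (hj : 3 ≤ j) (hj' : (j - 3) % 7 ≠ 3) :
    ∃ i, (j = 7 * i + 3 ∧ blockOrder j = 6 * i + 5) ∨ (j = 7 * i + 4 ∧ blockOrder j = 6 * i) ∨
      (j = 7 * i + 5 ∧ blockOrder j = 6 * i + 3) ∨ (j = 7 * i + 7 ∧ blockOrder j = 6 * i + 4) ∨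
      (j = 7 * i + 8 ∧ blockOrder j = 6 * i + 2) ∨ (j = 7 * i + 9 ∧ blockOrder j = 6 * i + 1) := by
  refine ⟨(j - 3) / 7, ?_⟩
  have hr : (j - 3) % 7 = 0 ∨ (j - 3) % 7 = 1 ∨ (j - 3) % 7 = 2 ∨ (j - 3) % 7 = 4 ∨
      (j - 3) % 7 = 5 ∨ (j - 3) % 7 = 6 := by omega
  rcases hr with h | h | h | h | h | h <;> simp only [blockOrder, h, and_true] <;> omega

theorem blockOrder_injOn {j k : ℕ} (hj : 3 ≤ j) (hj' : (j - 3) % 7 ≠ 3) (hk : 3 ≤ k)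
    (hk' : (k - 3) % 7 ≠ 3) (h : blockOrder j = blockOrder k) : j = k := by
  obtain ⟨i, hi⟩ := exists_blockOrder hj hj'
  obtain ⟨l, hl⟩ := exists_blockOrder hk hk'
  omega

/-- The intervals spanned by the edges in the outerplanar vertex order. -/
def IsBlockInterval (l u : ℕ) : Prop :=
  u = l + 1 ∨ ∃ i, (l + 1 = 6 * i ∧ u = 6 * i + 5) ∨ (l = 6 * i ∧ u = 6 * i + 5) ∨
    (l = 6 * i ∧ u = 6 * i + 3) ∨ (l = 6 * i + 3 ∧ u = 6 * i + 5) ∨ (l = 6 * i ∧ u = 6 * i + 2)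

theorem IsBlockInterval.not_cross {l u l' u' : ℕ} (h : IsBlockInterval l u)
    (h' : IsBlockInterval l' u') (h₁ : l < l') (h₂ : l' < u) : u' ≤ u := by
  rcases h with h | ⟨i, h⟩
  · omega
  · rcases h' with h' | ⟨i', h'⟩ <;> omega

theorem isBlockInterval_of_isStackParent {j k : ℕ} (hj : 3 ≤ j) (hj' : (j - 3) % 7 ≠ 3)
    (hk : 3 ≤ k) (hk' : (k - 3) % 7 ≠ 3) (h : IsStackParent blockParents j k) :
    IsBlockInterval (blockOrder j) (blockOrder k) ∨
      IsBlockInterval (blockOrder k) (blockOrder j) := by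
  obtain ⟨l, hl⟩ := exists_blockOrder hj hj'
  obtain ⟨i, hi⟩ := exists_blockOrder hk hk'
  have hpar := h.2.resolve_left (by omega)
  have nested : ∀ {l u : ℕ} (i : ℕ), ((l + 1 = 6 * i ∧ u = 6 * i + 5) ∨
      (l = 6 * i ∧ u = 6 * i + 5) ∨ (l = 6 * i ∧ u = 6 * i + 3) ∨
      (l = 6 * i + 3 ∧ u = 6 * i + 5) ∨ (l = 6 * i ∧ u = 6 * i + 2)) → IsBlockInterval l u :=
    fun i h => Or.inr ⟨i, h⟩
  rcases hi with ⟨rfl, hi⟩ | ⟨rfl, hi⟩ | ⟨rfl, hi⟩ | ⟨rfl, hi⟩ | ⟨rfl, hi⟩ | ⟨rfl, hi⟩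
  · rw [blockParents_a] at hpar
    exact Or.inl (nested i (by simp only at hpar; omega))
  · rw [blockParents_b] at hpar
    rcases hpar with hpar | hpar | hpar
    · exact Or.inr (nested i (by simp only at hpar; omega))
    · exact Or.inl (Or.inl (by simp only at hpar; omega))
    · simp only at hpar; omega
  · rw [blockParents_c] at hpar
    rcases hpar with hpar | hpar | hpar
    · exact Or.inl (nested i (by simp only at hpar; omega))
    · exact Or.inr (nested i (by simp only at hpar; omega))
    · simp only at hpar; omega
  · rw [blockParents_e] at hpar
    rcases hpar with hpar | hpar | hpar
    · simp only at hpar; omega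
    · exact Or.inl (Or.inl (by simp only at hpar; omega))
    · exact Or.inr (Or.inl (by simp only at hpar; omega))
  · rw [blockParents_f] at hpar
    rcases hpar with hpar | hpar | hpar
    · simp only at hpar; omega
    · exact Or.inr (Or.inl (by simp only at hpar; omega))
    · exact Or.inl (nested i (by simp only at hpar; omega))
  · rw [blockParents_g] at hpar
    rcases hpar with hpar | hpar | hpar
    · exact Or.inr (Or.inl (by simp only at hpar; omega))
    · simp only at hpar; omega
    · exact Or.inl (Or.inl (by simp only at hpar; omega))

theorem le_sO_finStackGraph (n : ℕ) : 6 * n ≤ sO (finStackGraph blockParents (7 * n + 3)) := by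
  let S : Finset (Fin (7 * n + 3)) :=
    Finset.univ.filter fun j => 3 ≤ (j : ℕ) ∧ ((j : ℕ) - 3) % 7 ≠ 3
  have hmem : ∀ j : (↑S : Set (Fin (7 * n + 3))), 3 ≤ (j.1 : ℕ) ∧ ((j.1 : ℕ) - 3) % 7 ≠ 3 :=
    fun j => (Finset.mem_filter.1 j.2).2
  have hout : IsOuterplanar ((finStackGraph blockParents (7 * n + 3)).induce (↑S : Set _)) := by
    refine isOuterplanar_of_noncrossing _ (fun j => (blockOrder j.1 : ℝ)) ?_ ?_
    · intro j k h
      exact Subtype.ext (Fin.ext (blockOrder_injOn (hmem j).1 (hmem j).2 (hmem k).1 (hmem k).2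
        (Nat.cast_injective h)))
    · have interval : ∀ u v,
          ((finStackGraph blockParents (7 * n + 3)).induce (↑S : Set _)).Adj u v →
          IsBlockInterval (blockOrder u.1) (blockOrder v.1) ∨
            IsBlockInterval (blockOrder v.1) (blockOrder u.1) := by
        rintro u v (h | h)
        · exact isBlockInterval_of_isStackParent (hmem u).1 (hmem u).2 (hmem v).1 (hmem v).2 h
        · exact (isBlockInterval_of_isStackParent (hmem v).1 (hmem v).2 (hmem u).1 (hmem u).2
            h).symm
      have lt_of : ∀ {l u}, IsBlockInterval l u → l < u := by
        rintro l u (h | ⟨i, h⟩) <;> omega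
      intro u v a b huv hab h1 h2 h3
      rw [Nat.cast_lt] at h1 h2 h3
      have huv := (interval u v huv).resolve_right fun h => by have := lt_of h; omega
      have hab := (interval a b hab).resolve_right fun h => by have := lt_of h; omega
      exact absurd (huv.not_cross hab h1 h2) (not_le.2 h3)
  have hcard : 6 * n ≤ S.card := by
    have := Finset.card_le_card_of_injOn (s := (Finset.univ : Finset (Fin n × Fin 6))) (t := S)
      (fun t => ⟨7 * t.1 + 3 + (if (t.2 : ℕ) < 3 then (t.2 : ℕ) else t.2 + 1), by
        split <;> omega⟩) (fun t _ => ?_) (fun t _ t' _ h => ?_)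
    · simpa [mul_comm] using this
    · refine Finset.mem_coe.2 (Finset.mem_filter.2 ⟨Finset.mem_univ _, ?_⟩)
      simp only
      split <;> omega
    · have h := congr_arg Fin.val h
      simp only at h
      refine Prod.ext (Fin.ext ?_) (Fin.ext ?_) <;> split at h <;> split at h <;> omega
  refine hcard.trans (le_csSup ⟨Fintype.card (Fin (7 * n + 3)), ?_⟩ ⟨S, hout, rfl⟩)
  rintro _ ⟨S', -, rfl⟩
  exact Finset.card_le_univ S'

theorem isPlaneTriangulation_finStackGraph {P : ℕ → ℕ × ℕ × ℕ}
    (hP : ∀ n, IsStackFace P n (P (n + 3))) (N : ℕ) :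
    IsPlaneTriangulation (finStackGraph P N) := by
  refine ⟨⟨stackEmbedding hP N⟩, fun u v huv hadj => ?_⟩
  have hstack := isStacking_of_isStackFace hP
  rcases lt_or_gt_of_ne huv with h | h
  · exact hstack.not_isPlanar_add_edge h hadj
  · rw [Sym2.eq_swap]
    exact hstack.not_isPlanar_add_edge h fun h' => hadj h'.symm

/-- For every real `M` there exists a plane triangulation `G` (with a
fixed embedding) with `s_o(G) − s_{o'}(G) > M`. -/
theorem stmt6 (M : ℝ) :
    ∃ (V : Type) (inst : Fintype V) (G : SimpleGraph V) (E : PlaneEmbedding G),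
      IsPlaneTriangulation G ∧
      M < ((@sO V inst G : ℝ) - (@sO' V inst G E : ℝ)) := by
  obtain ⟨n, hn⟩ := exists_nat_gt (M + 3)
  refine ⟨Fin (7 * n + 3), inferInstance, finStackGraph blockParents (7 * n + 3),
    stackEmbedding isStackFace_blockParents (7 * n + 3),
    isPlaneTriangulation_finStackGraph isStackFace_blockParents _, ?_⟩
  have hlower : (6 * n : ℝ) ≤ sO (finStackGraph blockParents (7 * n + 3)) := by
    exact_mod_cast le_sO_finStackGraph n
  have hupper : (sO' (stackEmbedding isStackFace_blockParents (7 * n + 3)) : ℝ) ≤ 5 * n + 3 := by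
    exact_mod_cast sO'_stackEmbedding_le n
  linarith
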